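/- Let p be a prime with p ≥ 5. There exists a Siegel modular form F_{p−1} ∈ M_{p−1}(Γ_2)_{Z_(p)} of degree 2 and weight p−1 with p-integral Fourier coefficients such that F_{p−1} ≡ 1 (mod p), i.e. a_{F_{p−1}}(0) ≡ 1 (mod p) and a_{F_{p−1}}(T) ≡ 0 (mod p) for all T ≠ 0. -/

import Mathlib

open Complex Matrix
open scoped ComplexOrder

noncomputable section

/-- `√d_K` for an imaginary quadratic discriminant `d < 0`,
taken as `√|d| · i` in the upper half plane. -/
def sqrtD (d : ℤ) : ℂ := Real.sqrt (-d) * Complex.I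

/-- The ring of integers `O_K = ℤ[(d + √d)/2]` of the imaginary quadratic field of
discriminant `d`, viewed as a subset of `ℂ`. -/
def ringInt (d : ℤ) : Set ℂ :=
  {z | ∃ a b : ℤ, z = (a : ℂ) + (b : ℂ) * (((d : ℂ) + sqrtD d) / 2)}

/-- The inverse different `D_K⁻¹ = O_K / √d_K`. -/
def invDiff (d : ℤ) : Set ℂ := {z | sqrtD d * z ∈ ringInt d}

/-- The Hermitian upper half-space of degree 2:
`Z` with `(Z - ᵗZ̄)/(2i)` positive definite. -/
def HermitianUpperHalfSpace : Set (Matrix (Fin 2) (Fin 2) ℂ) :=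
  {Z | ((Z - Zᴴ).map (fun w => w / (2 * Complex.I))).PosDef}

/-- The lattice `Λ₂(K)`: Hermitian matrices with integral diagonal and
`√d_K ·`(off-diagonal entries) in `O_K`. -/
def LambdaH (d : ℤ) : Set (Matrix (Fin 2) (Fin 2) ℂ) :=
  {H | H.IsHermitian ∧ (∀ i, ∃ n : ℤ, H i i = (n : ℂ)) ∧
    ∀ i j, sqrtD d * H i j ∈ ringInt d}

/-- Semi-positive elements of `Λ₂(K)`, the index set of Fourier expansions. -/
def HermLattice (d : ℤ) : Set (Matrix (Fin 2) (Fin 2) ℂ) :=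
  {H | H ∈ LambdaH d ∧ H.PosSemidef}

/-- The symplectic-form matrix `J₂ = [[0, -1], [1, 0]]` (2×2 blocks). -/
def J2 : Matrix (Fin 2 ⊕ Fin 2) (Fin 2 ⊕ Fin 2) ℂ :=
  Matrix.fromBlocks 0 (-1) 1 0

/-- The Hermitian modular group `U₂(O_K)`:
matrices with entries in `O_K` satisfying `ᵗM̄ J₂ M = J₂`. -/
def HermitianModularGroup (d : ℤ) : Set (Matrix (Fin 2 ⊕ Fin 2) (Fin 2 ⊕ Fin 2) ℂ) :=
  {M | (∀ i j, M i j ∈ ringInt d) ∧ Mᴴ * J2 * M = J2}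

/-- The fractional-linear action `Z ↦ (AZ + B)(CZ + D)⁻¹`. -/
def matAct (M : Matrix (Fin 2 ⊕ Fin 2) (Fin 2 ⊕ Fin 2) ℂ)
    (Z : Matrix (Fin 2) (Fin 2) ℂ) : Matrix (Fin 2) (Fin 2) ℂ :=
  (M.toBlocks₁₁ * Z + M.toBlocks₁₂) * (M.toBlocks₂₁ * Z + M.toBlocks₂₂)⁻¹

/-- The character `ν_k`: `det^{k/2}` for `K = ℚ(√-1)` (i.e. `d = -4`, `k` even),
and `det^k` for `K = ℚ(√-3)` (i.e. `d = -3`). -/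
def nuChar (d k : ℤ) (M : Matrix (Fin 2 ⊕ Fin 2) (Fin 2 ⊕ Fin 2) ℂ) : ℂ :=
  if d = -4 then M.det ^ (k / 2) else M.det ^ k

/-- A Hermitian modular form of degree 2, weight `k` and character `ν_k` for `U₂(O_K)`,
bundled with its Fourier expansion over the semi-positive part of `Λ₂(K)`. -/
structure HermitianModularForm (d k : ℤ) where
  toFun : Matrix (Fin 2) (Fin 2) ℂ → ℂ
  coeff : Matrix (Fin 2) (Fin 2) ℂ → ℂ
  holo : DifferentiableOn ℂ (fun Z : Fin 2 → Fin 2 → ℂ => toFun (Matrix.of Z))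
    {Z | Matrix.of Z ∈ HermitianUpperHalfSpace}
  transform : ∀ M ∈ HermitianModularGroup d, ∀ Z ∈ HermitianUpperHalfSpace,
    toFun (matAct M Z) =
      nuChar d k M * (M.toBlocks₂₁ * Z + M.toBlocks₂₂).det ^ k * toFun Z
  coeff_supported : ∀ H, coeff H ≠ 0 → H ∈ HermLattice d
  expansion : ∀ Z ∈ HermitianUpperHalfSpace,
    HasSum (fun H : HermLattice d =>
      coeff H * Complex.exp (2 * Real.pi * Complex.I * ((H : Matrix (Fin 2) (Fin 2) ℂ) * Z).trace))
      (toFun Z)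

/-- A Hermitian modular form is symmetric if `f(ᵗZ) = f(Z)`. -/
def IsSymmetricHMF {d k : ℤ} (f : HermitianModularForm d k) : Prop :=
  ∀ Z ∈ HermitianUpperHalfSpace, f.toFun Zᵀ = f.toFun Z

/-- `z` is a `p`-integral rational number: `z = a/b` with `p ∤ b`. -/
def IsPIntegral (p : ℕ) (z : ℂ) : Prop :=
  ∃ a b : ℤ, ¬ (p : ℤ) ∣ b ∧ (b : ℂ) * z = (a : ℂ)

/-- `z ≡ w (mod p^l)` in the local ring `ℤ_(p)`, i.e. `(z - w)/p^l` is `p`-integral. -/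
def ModCongr (p l : ℕ) (z w : ℂ) : Prop :=
  IsPIntegral p ((z - w) / (p : ℂ) ^ l)


/-- The lexicographic order on `Λ₂(K)` used to define `ord_p`:
compare first `tr H`, then the `(1,1)`-entry `m`, then (for off-diagonal entry
`(a + b i)/2`) first `a`, then `b`. -/
def lexLt (H H' : Matrix (Fin 2) (Fin 2) ℂ) : Prop :=
  H.trace.re < H'.trace.re ∨
    (H.trace = H'.trace ∧
      ((H 0 0).re < (H' 0 0).re ∨
        (H 0 0 = H' 0 0 ∧
          ((H 0 1).re < (H' 0 1).re ∨
            ((H 0 1).re = (H' 0 1).re ∧ (H 0 1).im < (H' 0 1).im)))))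

/-- The Siegel upper half-space of degree `n`: symmetric complex matrices with
positive definite imaginary part. -/
def SiegelUpperHalfSpace (n : ℕ) : Set (Matrix (Fin n) (Fin n) ℂ) :=
  {Z | Z.IsSymm ∧ ((Z - Zᴴ).map (fun w => w / (2 * Complex.I))).PosDef}

/-- The symplectic-form matrix over `ℤ` in degree `n`. -/
def Jn (n : ℕ) : Matrix (Fin n ⊕ Fin n) (Fin n ⊕ Fin n) ℤ :=
  Matrix.fromBlocks 0 (-1) 1 0

/-- The Siegel modular group `Γ_n = Sp_n(ℤ)` (as a set of `2n × 2n` integer matrices). -/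
def SiegelModularGroup (n : ℕ) : Set (Matrix (Fin n ⊕ Fin n) (Fin n ⊕ Fin n) ℤ) :=
  {M | Mᵀ * Jn n * M = Jn n}

/-- The fractional-linear action of an integral symplectic matrix on the Siegel
upper half-space. -/
def matActS {n : ℕ} (M : Matrix (Fin n ⊕ Fin n) (Fin n ⊕ Fin n) ℤ)
    (Z : Matrix (Fin n) (Fin n) ℂ) : Matrix (Fin n) (Fin n) ℂ :=
  ((M.map (fun a => (a : ℂ))).toBlocks₁₁ * Z + (M.map (fun a => (a : ℂ))).toBlocks₁₂) *
    ((M.map (fun a => (a : ℂ))).toBlocks₂₁ * Z + (M.map (fun a => (a : ℂ))).toBlocks₂₂)⁻¹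

/-- The index lattice of Fourier expansions of Siegel modular forms of level `N`:
semi-positive symmetric rational matrices `T` with `N·T` half-integral,
i.e. `T ∈ (1/N)Λ_n`. -/
def SiegelLattice (n : ℕ) (N : ℕ) : Set (Matrix (Fin n) (Fin n) ℚ) :=
  {T | T.IsSymm ∧ (∀ i, ∃ a : ℤ, (N : ℚ) * T i i = (a : ℚ)) ∧
    (∀ i j, ∃ a : ℤ, 2 * (N : ℚ) * T i j = (a : ℚ)) ∧
    (T.map (fun q => (q : ℝ))).PosSemidef}

/-- A Siegel modular form of degree `n` and weight `k` for a subgroup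
`Γ ⊆ Γ_n = Sp_n(ℤ)` of level `N`, bundled with its Fourier expansion. For the
full modular group take `Γ = SiegelModularGroup n` and `N = 1`. -/
structure SiegelModularForm (n : ℕ) (k : ℤ)
    (Γ : Set (Matrix (Fin n ⊕ Fin n) (Fin n ⊕ Fin n) ℤ)) (N : ℕ) where
  toFun : Matrix (Fin n) (Fin n) ℂ → ℂ
  coeff : Matrix (Fin n) (Fin n) ℚ → ℂ
  holo : DifferentiableOn ℂ (fun Z : Fin n → Fin n → ℂ => toFun (Matrix.of Z))
    {Z | Matrix.of Z ∈ SiegelUpperHalfSpace n}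
  transform : ∀ M ∈ Γ, ∀ Z ∈ SiegelUpperHalfSpace n,
    toFun (matActS M Z) =
      ((M.map (fun a => (a : ℂ))).toBlocks₂₁ * Z +
        (M.map (fun a => (a : ℂ))).toBlocks₂₂).det ^ k * toFun Z
  coeff_supported : ∀ T, coeff T ≠ 0 → T ∈ SiegelLattice n N
  expansion : ∀ Z ∈ SiegelUpperHalfSpace n,
    HasSum (fun T : SiegelLattice n N =>
      coeff T * Complex.exp (2 * Real.pi * Complex.I *
        (((T : Matrix (Fin n) (Fin n) ℚ).map (fun q => (q : ℂ))) * Z).trace))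
      (toFun Z)


/-- A Hermitian cusp form (degree 2, class number one field): the Fourier
coefficients vanish off the positive definite part of the lattice. -/
def IsCuspHMF {d k : ℤ} (f : HermitianModularForm d k) : Prop :=
  ∀ H, ¬ H.PosDef → f.coeff H = 0

/-- `H0 = ord_p f`: `H0` is the minimal element of `Λ₂(K)`, in the lexicographic
order `lexLt`, whose Fourier coefficient is not divisible by `p`. -/
def IsOrdP (p : ℕ) {d k : ℤ} (f : HermitianModularForm d k)
    (H0 : Matrix (Fin 2) (Fin 2) ℂ) : Prop :=
  H0 ∈ HermLattice d ∧ ¬ ModCongr p 1 (f.coeff H0) 0 ∧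
    ∀ H ∈ HermLattice d, lexLt H H0 → ModCongr p 1 (f.coeff H) 0

/-- The additive character `x ↦ e^{2πix}`. -/
def expTwoPi (x : ℂ) : ℂ := cexp (2 * Real.pi * I * x)

lemma expTwoPi_add (x y : ℂ) : expTwoPi (x + y) = expTwoPi x * expTwoPi y := by
  simp [expTwoPi, mul_add, Complex.exp_add]

lemma expTwoPi_zero : expTwoPi 0 = 1 := by simp [expTwoPi]

lemma expTwoPi_int (n : ℤ) : expTwoPi n = 1 := by
  rw [expTwoPi, mul_comm]
  exact Complex.exp_int_mul_two_pi_mul_I n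

lemma expTwoPi_natCast_mul (n : ℕ) (x : ℂ) : expTwoPi (n * x) = expTwoPi x ^ n := by
  rw [expTwoPi, expTwoPi, ← Complex.exp_nat_mul]
  ring_nf

lemma norm_expTwoPi (x : ℂ) : ‖expTwoPi x‖ = Real.exp (-(2 * Real.pi * x.im)) := by
  simp [expTwoPi, Complex.norm_exp]

/-- A sequence of integers of at most polynomial growth. -/
def HasPolyGrowth (c : ℕ → ℤ) : Prop :=
  ∃ C K : ℕ, ∀ N, |c N| ≤ C * ((N : ℤ) + 1) ^ K

lemma HasPolyGrowth.add {c c' : ℕ → ℤ} (hc : HasPolyGrowth c) (hc' : HasPolyGrowth c') :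
    HasPolyGrowth fun N ↦ c N + c' N := by
  obtain ⟨C, K, h⟩ := hc
  obtain ⟨C', K', h'⟩ := hc'
  refine ⟨C + C', K + K', fun N ↦ ?_⟩
  have h1 : ((N : ℤ) + 1) ^ K ≤ ((N : ℤ) + 1) ^ (K + K') :=
    pow_le_pow_right₀ (by linarith [Int.natCast_nonneg N]) (by omega)
  have h2 : ((N : ℤ) + 1) ^ K' ≤ ((N : ℤ) + 1) ^ (K + K') :=
    pow_le_pow_right₀ (by linarith [Int.natCast_nonneg N]) (by omega)
  calc |c N + c' N| ≤ |c N| + |c' N| := abs_add_le _ _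
    _ ≤ C * ((N : ℤ) + 1) ^ K + C' * ((N : ℤ) + 1) ^ K' := add_le_add (h N) (h' N)
    _ ≤ C * ((N : ℤ) + 1) ^ (K + K') + C' * ((N : ℤ) + 1) ^ (K + K') := by gcongr
    _ = _ := by push_cast; ring

lemma HasPolyGrowth.summable_norm {c : ℕ → ℤ} (hc : HasPolyGrowth c) {q : ℂ} (hq : ‖q‖ < 1) :
    Summable fun N ↦ ‖(c N : ℂ) * q ^ N‖ := by
  obtain ⟨C, K, h⟩ := hc
  have h1 : Summable fun N : ℕ ↦ ((N : ℝ) + 1) ^ K * ‖q‖ ^ N := by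
    have h2 := summable_pow_mul_geometric_of_norm_lt_one K
      (show ‖(‖q‖ : ℝ)‖ < 1 by simpa using hq)
    by_cases h0 : ‖q‖ = 0
    · refine summable_of_ne_finset_zero (s := {0}) fun N hN ↦ ?_
      simp at hN
      simp [h0, hN]
    · refine (((summable_nat_add_iff 1).mpr h2).mul_right ‖q‖⁻¹).congr fun N ↦ ?_
      field_simp
      push_cast
      ring
  refine Summable.of_nonneg_of_le (fun _ ↦ norm_nonneg _) (fun N ↦ ?_) (h1.mul_left (C : ℝ))
  rw [norm_mul, norm_pow, ← mul_assoc]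
  gcongr
  rw [Complex.norm_intCast]
  exact_mod_cast h N

/-- `f ∈ ℤ⟦X⟧` has polynomially growing coefficients supported in the residue class `i` mod `4`,
and is the expansion of `v` in powers of `e^{2πiτ/4}`. -/
structure IsQuarterExpansion (i : ZMod 4) (f : PowerSeries ℤ) (v : ℂ → ℂ) : Prop where
  growth : HasPolyGrowth fun N ↦ f.coeff N
  support : ∀ N, f.coeff N ≠ 0 → (N : ZMod 4) = i
  hasSum : ∀ τ : ℂ, 0 < τ.im → HasSum (fun N ↦ (f.coeff N : ℂ) * expTwoPi (τ / 4) ^ N) (v τ)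

lemma norm_expTwoPi_lt_one {τ : ℂ} (h : 0 < τ.im) : ‖expTwoPi τ‖ < 1 := by
  rw [norm_expTwoPi, Real.exp_lt_one_iff]
  have := Real.pi_pos
  have : 0 < 2 * Real.pi * τ.im := by positivity
  linarith

lemma norm_expTwoPi_div_four_lt_one {τ : ℂ} (h : 0 < τ.im) : ‖expTwoPi (τ / 4)‖ < 1 := by
  apply norm_expTwoPi_lt_one
  have : (τ / 4).im = τ.im / 4 := by simp
  rw [this]
  positivity

namespace IsQuarterExpansion

variable {i j : ZMod 4} {f g : PowerSeries ℤ} {v w : ℂ → ℂ}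

lemma add (hf : IsQuarterExpansion i f v) (hg : IsQuarterExpansion i g w) :
    IsQuarterExpansion i (f + g) (fun τ ↦ v τ + w τ) where
  growth := by simpa only [map_add] using hf.growth.add hg.growth
  support N hN := by
    by_contra hne
    rw [map_add] at hN
    have h1 : f.coeff N = 0 := by_contra fun h ↦ hne (hf.support N h)
    have h2 : g.coeff N = 0 := by_contra fun h ↦ hne (hg.support N h)
    simp [h1, h2] at hN
  hasSum τ hτ := by
    refine ((hf.hasSum τ hτ).add (hg.hasSum τ hτ)).congr_fun fun N ↦ ?_
    simp [add_mul]

lemma mul (hf : IsQuarterExpansion i f v) (hg : IsQuarterExpansion j g w) :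
    IsQuarterExpansion (i + j) (f * g) (fun τ ↦ v τ * w τ) where
  growth := by
    obtain ⟨C, K, h⟩ := hf.growth
    obtain ⟨C', K', h'⟩ := hg.growth
    refine ⟨C * C', K + K' + 1, fun N ↦ ?_⟩
    simp only [PowerSeries.coeff_mul]
    refine (Finset.abs_sum_le_sum_abs _ _).trans ?_
    have hb : ∀ x ∈ Finset.HasAntidiagonal.antidiagonal N, |f.coeff x.1 * g.coeff x.2| ≤
        (C * C' : ℤ) * ((N : ℤ) + 1) ^ (K + K') := by
      intro x hx
      rw [Finset.HasAntidiagonal.mem_antidiagonal] at hx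
      rw [abs_mul]
      calc |f.coeff x.1| * |g.coeff x.2|
          ≤ (C * ((x.1 : ℤ) + 1) ^ K) * (C' * ((x.2 : ℤ) + 1) ^ K') :=
            mul_le_mul (h _) (h' _) (abs_nonneg _) (by positivity)
        _ ≤ (C * ((N : ℤ) + 1) ^ K) * (C' * ((N : ℤ) + 1) ^ K') := by gcongr <;> omega
        _ = _ := by ring
    refine (Finset.sum_le_sum hb).trans ?_
    simp only [Finset.sum_const, Finset.Nat.card_antidiagonal, nsmul_eq_mul]
    push_cast
    apply le_of_eq
    ring
  support N hN := by
    rw [PowerSeries.coeff_mul] at hN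
    obtain ⟨x, hx, hne⟩ := Finset.exists_ne_zero_of_sum_ne_zero hN
    rw [Finset.HasAntidiagonal.mem_antidiagonal] at hx
    rw [← hx, Nat.cast_add, hf.support _ (left_ne_zero_of_mul hne),
      hg.support _ (right_ne_zero_of_mul hne)]
  hasSum τ hτ := by
    have hq := norm_expTwoPi_div_four_lt_one hτ
    have h1 := hf.growth.summable_norm hq
    have h2 := hg.growth.summable_norm hq
    have h3 := (summable_norm_sum_mul_antidiagonal_of_summable_norm h1 h2).of_norm.hasSum
    rw [← tsum_mul_tsum_eq_tsum_sum_antidiagonal_of_summable_norm h1 h2,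
      (hf.hasSum τ hτ).tsum_eq, (hg.hasSum τ hτ).tsum_eq] at h3
    refine h3.congr_fun fun N ↦ ?_
    rw [PowerSeries.coeff_mul, Int.cast_sum, Finset.sum_mul]
    refine Finset.sum_congr rfl fun x hx ↦ ?_
    rw [Finset.HasAntidiagonal.mem_antidiagonal] at hx
    rw [← hx, pow_add]
    push_cast
    ring

lemma intCast (n : ℤ) : IsQuarterExpansion 0 (n : PowerSeries ℤ) (fun _ ↦ n) where
  growth := by
    refine ⟨n.natAbs, 0, fun N ↦ ?_⟩
    simp only [← map_intCast (PowerSeries.C (R := ℤ)), PowerSeries.coeff_C]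
    split_ifs <;> simp
  support N hN := by
    rw [← map_intCast (PowerSeries.C (R := ℤ)), PowerSeries.coeff_C] at hN
    split_ifs at hN with h
    · simp [h]
    · simp at hN
  hasSum τ hτ := by
    rw [← map_intCast (PowerSeries.C (R := ℤ))]
    convert hasSum_single 0 ?_ using 1
    · simp
    · intro N hN
      rw [PowerSeries.coeff_C, if_neg hN]
      simp

lemma pow (hf : IsQuarterExpansion i f v) (n : ℕ) :
    IsQuarterExpansion (n * i) (f ^ n) (fun τ ↦ v τ ^ n) := by
  induction n with
  | zero => simpa using intCast 1
  | succ n ih => simpa [pow_succ, add_mul] using ih.mul hf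

end IsQuarterExpansion

/-- The theta series `∑ q^{r²/4} ζ^r` over even `r`. -/
def thetaEven (τ z : ℂ) : ℂ := jacobiTheta₂ (2 * z) (2 * τ)

/-- The theta series `∑ q^{r²/4} ζ^r` over odd `r`. -/
def thetaOdd (τ z : ℂ) : ℂ := jacobiTheta₂ z (τ / 2) - thetaEven τ z

lemma hasSum_thetaEven {τ : ℂ} (hτ : 0 < τ.im) (z : ℂ) :
    HasSum (fun r : ℤ ↦ if Even r then expTwoPi (r ^ 2 * (τ / 4) + r * z) else 0)
      (thetaEven τ z) := by
  have h := hasSum_jacobiTheta₂_term (2 * z) (τ := 2 * τ) (by simpa using hτ)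
  have hinj : Function.Injective fun n : ℤ ↦ 2 * n := fun a b h ↦ by simpa using h
  rw [thetaEven, ← hinj.hasSum_iff]
  · convert h using 2 with n
    simp only [Function.comp, even_two_mul, if_true, jacobiTheta₂_term, expTwoPi]
    congr 1
    push_cast
    ring
  · intro r hr
    rw [if_neg]
    rintro ⟨s, hs⟩
    exact hr ⟨s, by simp only; omega⟩

lemma hasSum_thetaOdd {τ : ℂ} (hτ : 0 < τ.im) (z : ℂ) :
    HasSum (fun r : ℤ ↦ if Even r then 0 else expTwoPi (r ^ 2 * (τ / 4) + r * z))
      (thetaOdd τ z) := by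
  have h := hasSum_jacobiTheta₂_term z (τ := τ / 2) (by
    have : (τ / 2).im = τ.im / 2 := by simp
    rw [this]
    positivity)
  refine (h.sub (hasSum_thetaEven hτ z)).congr_fun fun r ↦ ?_
  rw [show jacobiTheta₂_term r z (τ / 2) = expTwoPi (r ^ 2 * (τ / 4) + r * z) by
    rw [jacobiTheta₂_term, expTwoPi]
    ring_nf]
  split_ifs <;> simp

lemma jacobiTheta₂_neg_inv {τ : ℂ} (hτ : τ ≠ 0) (z : ℂ) :
    jacobiTheta₂ (z / τ) (-1 / τ) =
      (-I * τ) ^ (1 / 2 : ℂ) * expTwoPi (z ^ 2 / (2 * τ)) * jacobiTheta₂ z τ := by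
  have hs : (-I * τ) ^ (1 / 2 : ℂ) ≠ 0 := by simp [Complex.cpow_eq_zero_iff, hτ]
  have he : expTwoPi (z ^ 2 / (2 * τ)) * cexp (-Real.pi * I * z ^ 2 / τ) = 1 := by
    rw [expTwoPi, ← Complex.exp_add, show 2 * (Real.pi : ℂ) * I * (z ^ 2 / (2 * τ)) +
      -Real.pi * I * z ^ 2 / τ = 0 by field_simp; ring, Complex.exp_zero]
  rw [jacobiTheta₂_functional_equation z τ]
  generalize (-I * τ) ^ (1 / 2 : ℂ) = s at hs ⊢
  calc _ = (s * (1 / s)) * 1 * jacobiTheta₂ (z / τ) (-1 / τ) := by field_simp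
    _ = _ := by rw [← he]; ring

lemma thetaEven_neg_inv {τ : ℂ} (hτ : 0 < τ.im) (z : ℂ) :
    thetaEven (-1 / τ) (z / τ) =
      (-I * (τ / 2)) ^ (1 / 2 : ℂ) * expTwoPi (z ^ 2 / τ) * (thetaEven τ z + thetaOdd τ z) := by
  have hτ0 : τ ≠ 0 := by rintro rfl; simp at hτ
  have h := jacobiTheta₂_neg_inv (τ := τ / 2) (by simpa using hτ0) z
  rw [thetaOdd, add_sub_cancel, thetaEven, show 2 * (z / τ) = z / (τ / 2) by field_simp,
    show 2 * (-1 / τ) = -1 / (τ / 2) by field_simp, h, show 2 * (τ / 2) = τ by ring]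

lemma cpow_half_two_mul {τ : ℂ} (hτ : τ ≠ 0) :
    (-I * (2 * τ)) ^ (1 / 2 : ℂ) = 2 * (-I * (τ / 2)) ^ (1 / 2 : ℂ) := by
  have h0 : -I * (τ / 2) ≠ 0 := by simp [hτ]
  have h4 : ((4 : ℝ) : ℂ) * (-I * (τ / 2)) = -I * (2 * τ) := by push_cast; ring
  rw [← h4, Complex.cpow_def_of_ne_zero (by simp [hτ]), Complex.cpow_def_of_ne_zero h0,
    Complex.log_ofReal_mul (by norm_num) h0, add_mul, Complex.exp_add]
  congr 1
  rw [show (4 : ℝ) = 2 ^ 2 by norm_num, Real.log_pow, show ((((2 : ℕ) : ℝ) * Real.log 2 : ℝ) : ℂ)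
    * (1 / 2) = ((Real.log 2 : ℝ) : ℂ) by push_cast; ring, ← Complex.ofReal_exp,
    Real.exp_log (by norm_num)]
  simp

lemma thetaOdd_neg_inv {τ : ℂ} (hτ : 0 < τ.im) (z : ℂ) :
    thetaOdd (-1 / τ) (z / τ) =
      (-I * (τ / 2)) ^ (1 / 2 : ℂ) * expTwoPi (z ^ 2 / τ) * (thetaEven τ z - thetaOdd τ z) := by
  have hτ0 : τ ≠ 0 := by rintro rfl; simp at hτ
  have h2 : jacobiTheta₂ (z / τ) (-1 / τ / 2) =
      (-I * (2 * τ)) ^ (1 / 2 : ℂ) * expTwoPi (z ^ 2 / τ) * thetaEven τ z := by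
    have h := jacobiTheta₂_neg_inv (τ := 2 * τ) (by simpa using hτ0) (2 * z)
    rw [show z / τ = 2 * z / (2 * τ) by field_simp, show -1 / τ / 2 = -1 / (2 * τ) by field_simp, h,
      thetaEven, show (2 * z) ^ 2 / (2 * (2 * τ)) = z ^ 2 / τ by field_simp]
  rw [thetaOdd, h2, thetaEven_neg_inv hτ, cpow_half_two_mul hτ0]
  ring

lemma sq_cpow_half (x : ℂ) : (x ^ (1 / 2 : ℂ)) ^ 2 = x := by
  rw [← Complex.cpow_nat_mul]
  simp

/-- The formal theta series `∑ X^{r²}` over integers `r` satisfying `P`. -/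
def squareSeries (P : ℤ → Prop) [DecidablePred P] : PowerSeries ℤ :=
  PowerSeries.mk fun N ↦ (((Finset.Icc (-N : ℤ) N).filter fun r ↦ P r ∧ r ^ 2 = N).card : ℤ)

lemma hasPolyGrowth_squareSeries (P : ℤ → Prop) [DecidablePred P] :
    HasPolyGrowth fun N ↦ (squareSeries P).coeff N := by
  refine ⟨2, 1, fun N ↦ ?_⟩
  simp only [squareSeries, PowerSeries.coeff_mk]
  rw [abs_of_nonneg (by positivity)]
  have h := Finset.card_filter_le (Finset.Icc (-N : ℤ) N) fun r ↦ P r ∧ r ^ 2 = N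
  rw [Int.card_Icc] at h
  push_cast
  rw [pow_one]
  omega

lemma hasSum_squareSeries {P : ℤ → Prop} [DecidablePred P] {q v : ℂ}
    (h : HasSum (fun r : ℤ ↦ if P r then q ^ r.natAbs ^ 2 else 0) v) :
    HasSum (fun N ↦ ((squareSeries P).coeff N : ℂ) * q ^ N) v := by
  refine (h.tsum_fiberwise fun r : ℤ ↦ r.natAbs ^ 2).congr_fun fun N ↦ ?_
  rw [tsum_subtype ((fun r : ℤ ↦ r.natAbs ^ 2) ⁻¹' {N})
    (fun r : ℤ ↦ if P r then q ^ r.natAbs ^ 2 else 0),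
    tsum_eq_sum (s := (Finset.Icc (-N : ℤ) N).filter fun r ↦ P r ∧ r ^ 2 = N)]
  · simp only [squareSeries, PowerSeries.coeff_mk]
    rw [Finset.sum_congr rfl (g := fun _ ↦ q ^ N), Finset.sum_const, nsmul_eq_mul]
    · simp
    · intro r hr
      simp only [Finset.mem_filter] at hr
      have hN : r.natAbs ^ 2 = N := by
        zify
        rw [sq_abs]
        exact hr.2.2
      rw [Set.indicator_of_mem (by simpa using hN), if_pos hr.2.1, hN]
  · intro r hr
    by_cases hN : r.natAbs ^ 2 = N
    · rw [Set.indicator_of_mem (by simpa using hN), if_neg]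
      intro hP
      apply hr
      have h1 : r ^ 2 = N := by rw [← hN]; push_cast; rw [sq_abs]
      have h2 : r.natAbs ≤ N := by rw [← hN]; exact Nat.le_self_pow (by norm_num) _
      simp only [Finset.mem_filter, Finset.mem_Icc]
      exact ⟨⟨by omega, by omega⟩, hP, h1⟩
    · exact Set.indicator_of_notMem (by simpa using hN) _

lemma expTwoPi_sq_mul (r : ℤ) (τ z : ℂ) (hz : z = 0) :
    expTwoPi (r ^ 2 * τ + r * z) = expTwoPi τ ^ r.natAbs ^ 2 := by
  rw [← expTwoPi_natCast_mul, hz, mul_zero, add_zero]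
  congr 2
  rw [← Int.cast_natCast]
  exact_mod_cast (Int.natAbs_sq r).symm

lemma squareSeries_support {P : ℤ → Prop} [DecidablePred P] {N : ℕ}
    (h : (squareSeries P).coeff N ≠ 0) : ∃ r : ℤ, P r ∧ r ^ 2 = N := by
  simp only [squareSeries, PowerSeries.coeff_mk, ne_eq, Nat.cast_eq_zero, Finset.card_eq_zero]
    at h
  obtain ⟨r, hr⟩ := Finset.nonempty_iff_ne_empty.mpr h
  exact ⟨r, (Finset.mem_filter.mp hr).2⟩

lemma even_sq_residue {r : ℤ} (hr : Even r) : (r : ZMod 4) ^ 2 = 0 := by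
  obtain ⟨s, rfl⟩ := hr
  rw [← two_mul]
  push_cast
  rw [mul_pow, show (2 : ZMod 4) ^ 2 = 0 by decide, zero_mul]

lemma odd_sq_residue {r : ℤ} (hr : ¬ Even r) : (r : ZMod 4) ^ 2 = 1 := by
  obtain ⟨s, rfl⟩ := Int.not_even_iff_odd.mp hr
  push_cast
  rw [show (2 * (s : ZMod 4) + 1) ^ 2 = 4 * (s * (s + 1)) + 1 by ring,
    show (4 : ZMod 4) = 0 by decide, zero_mul, zero_add]

lemma isQuarterExpansion_thetaEven :
    IsQuarterExpansion 0 (squareSeries fun r ↦ Even r) fun τ ↦ thetaEven τ 0 where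
  growth := hasPolyGrowth_squareSeries _
  support N hN := by
    obtain ⟨r, hr, h⟩ := squareSeries_support hN
    rw [← Int.cast_natCast, ← h, Int.cast_pow, even_sq_residue hr]
  hasSum τ hτ := by
    refine hasSum_squareSeries ((hasSum_thetaEven hτ 0).congr_fun fun r ↦ ?_)
    rw [expTwoPi_sq_mul _ _ _ rfl]

lemma isQuarterExpansion_thetaOdd :
    IsQuarterExpansion 1 (squareSeries fun r ↦ ¬ Even r) fun τ ↦ thetaOdd τ 0 where
  growth := hasPolyGrowth_squareSeries _
  support N hN := by
    obtain ⟨r, hr, h⟩ := squareSeries_support hN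
    rw [← Int.cast_natCast, ← h, Int.cast_pow, odd_sq_residue hr]
  hasSum τ hτ := by
    refine hasSum_squareSeries ((hasSum_thetaOdd hτ 0).congr_fun fun r ↦ ?_)
    rw [expTwoPi_sq_mul _ _ _ rfl]
    split_ifs <;> simp_all

/-- The extension by zero to the integers of a sequence indexed by the naturals. -/
def extendZero (c : ℕ → ℤ) (D : ℤ) : ℤ := if 0 ≤ D then c D.toNat else 0

/-- `φ` is a Jacobi form of index one and weight `k` for which the Fourier coefficient at
`q^n ζ^r` is `c (4n - r²)`. -/
structure IsJacobiForm (k : ℕ) (c : ℕ → ℤ) (φ : ℂ → ℂ → ℂ) : Prop where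
  growth : HasPolyGrowth c
  hasSum : ∀ τ z : ℂ, 0 < τ.im → HasSum (fun x : ℤ × ℤ ↦
    (extendZero c (4 * x.1 - x.2 ^ 2) : ℂ) * expTwoPi (x.1 * τ + x.2 * z)) (φ τ z)
  neg_inv : ∀ τ z : ℂ, 0 < τ.im → φ (-1 / τ) (z / τ) = τ ^ k * expTwoPi (z ^ 2 / τ) * φ τ z

lemma residue_toNat {n r : ℤ} (h : 0 ≤ 4 * n - r ^ 2) :
    (((4 * n - r ^ 2).toNat : ℕ) : ZMod 4) = -(r : ZMod 4) ^ 2 := by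
  rw [← Int.cast_natCast, Int.toNat_of_nonneg h]
  push_cast
  rw [show (4 : ZMod 4) = 0 by decide]
  ring

lemma expTwoPi_toNat_mul {n r : ℤ} (h : 0 ≤ 4 * n - r ^ 2) (τ z : ℂ) :
    expTwoPi (τ / 4) ^ (4 * n - r ^ 2).toNat * expTwoPi (r ^ 2 * (τ / 4) + r * z) =
      expTwoPi (n * τ + r * z) := by
  rw [← expTwoPi_natCast_mul, ← expTwoPi_add, ← Int.cast_natCast, Int.toNat_of_nonneg h]
  push_cast
  ring_nf

lemma isJacobiForm_of_quarterExpansion {k : ℕ} {f g : PowerSeries ℤ} {v w : ℂ → ℂ}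
    (hf : IsQuarterExpansion 0 f v) (hg : IsQuarterExpansion 3 g w)
    (h : ∀ τ z : ℂ, 0 < τ.im → v (-1 / τ) * thetaEven (-1 / τ) (z / τ) +
      w (-1 / τ) * thetaOdd (-1 / τ) (z / τ) =
      τ ^ k * expTwoPi (z ^ 2 / τ) * (v τ * thetaEven τ z + w τ * thetaOdd τ z)) :
    IsJacobiForm k (fun N ↦ f.coeff N + g.coeff N)
      fun τ z ↦ v τ * thetaEven τ z + w τ * thetaOdd τ z where
  growth := hf.growth.add hg.growth
  neg_inv := h
  hasSum τ z hτ := by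
    have hq := norm_expTwoPi_div_four_lt_one hτ
    have he := hasSum_thetaEven hτ z
    have ho := hasSum_thetaOdd hτ z
    have hmul {F : ℕ → ℂ} {G : ℤ → ℂ} {a b : ℂ} (hF : HasSum F a) (hG : HasSum G b)
        (hF' : Summable fun N ↦ ‖F N‖) : HasSum (fun x : ℕ × ℤ ↦ F x.1 * G x.2) (a * b) :=
      hF.mul hG (summable_mul_of_summable_norm hF' hG.summable.norm)
    have h1 := (hmul (hf.hasSum τ hτ) he (hf.growth.summable_norm hq)).add
      (hmul (hg.hasSum τ hτ) ho (hg.growth.summable_norm hq))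
    have hinj : Function.Injective fun x : ℕ × ℤ ↦ ((x.1 : ℤ), x.2) := by
      rintro ⟨a, b⟩ ⟨c, d⟩ h
      simpa using h
    set G : ℤ × ℤ → ℂ := fun x ↦ if 0 ≤ x.1 then
      (f.coeff x.1.toNat : ℂ) * expTwoPi (τ / 4) ^ x.1.toNat *
          (if Even x.2 then expTwoPi (x.2 ^ 2 * (τ / 4) + x.2 * z) else 0) +
        (g.coeff x.1.toNat : ℂ) * expTwoPi (τ / 4) ^ x.1.toNat *
          (if Even x.2 then 0 else expTwoPi (x.2 ^ 2 * (τ / 4) + x.2 * z)) else 0 with hG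
    have h2 : HasSum G (v τ * thetaEven τ z + w τ * thetaOdd τ z) := by
      rw [← hinj.hasSum_iff]
      · exact h1.congr_fun fun x ↦ by simp [hG]
      · rintro ⟨N, r⟩ hN
        rw [hG]
        refine if_neg fun h0 ↦ hN ⟨(N.toNat, r), by simpa using h0⟩
    have hinj2 : Function.Injective fun x : ℤ × ℤ ↦ (4 * x.1 - x.2 ^ 2, x.2) := by
      rintro ⟨a, b⟩ ⟨c, d⟩ h
      simp only [Prod.mk.injEq] at h ⊢
      obtain ⟨h, rfl⟩ := h
      exact ⟨by omega, rfl⟩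
    rw [← hinj2.hasSum_iff] at h2
    · refine h2.congr_fun ?_
      rintro ⟨n, r⟩
      simp only [Function.comp, hG, extendZero]
      split_ifs with hD hr
      · have hg0 : g.coeff (4 * n - r ^ 2).toNat = 0 := by
          by_contra hne
          have h3 := hg.support _ hne
          rw [residue_toNat hD, even_sq_residue hr] at h3
          exact absurd h3 (by decide)
        rw [hg0, mul_assoc, expTwoPi_toNat_mul hD]
        simp
      · have hf0 : f.coeff (4 * n - r ^ 2).toNat = 0 := by
          by_contra hne
          have h3 := hf.support _ hne
          rw [residue_toNat hD, odd_sq_residue hr] at h3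
          exact absurd h3 (by decide)
        rw [hf0, mul_assoc (g.coeff _ : ℂ), expTwoPi_toNat_mul hD]
        simp
      · simp
    · rintro ⟨N, r⟩ hx
      have hmem : 0 ≤ N → ((N.toNat : ℕ) : ZMod 4) + (r : ZMod 4) ^ 2 ≠ 0 := by
        intro h0 h4
        have h5 : ((N + r ^ 2 : ℤ) : ZMod 4) = 0 := by
          rw [← h4]
          push_cast
          rw [show ((N.toNat : ℕ) : ZMod 4) = (((N.toNat : ℕ) : ℤ) : ZMod 4) from
            (Int.cast_natCast _).symm,
            Int.toNat_of_nonneg h0]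
        obtain ⟨n, hn⟩ := (ZMod.intCast_zmod_eq_zero_iff_dvd _ 4).mp h5
        refine hx ⟨(n, r), ?_⟩
        simp only [Prod.mk.injEq, and_true]
        push_cast at hn
        omega
      simp only [hG]
      split_ifs with hD hr
      · have hf0 : f.coeff N.toNat = 0 := by
          by_contra hne
          exact hmem hD (by rw [hf.support _ hne, even_sq_residue hr, add_zero])
        simp [hf0]
      · have hg0 : g.coeff N.toNat = 0 := by
          by_contra hne
          exact hmem hD (by rw [hg.support _ hne, odd_sq_residue hr]; decide)
        simp [hg0]
      · rfl

/-- The behaviour under `τ ↦ -1/τ` of the weight enumerator of the Hamming code. -/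
lemma weightEnumerator_neg_inv {τ s : ℂ} (hs : s ^ 2 = -I * (τ / 2)) (A B : ℂ) :
    (s * (A + B)) ^ 8 + 14 * (s * (A + B)) ^ 4 * (s * (A - B)) ^ 4 + (s * (A - B)) ^ 8 =
      τ ^ 4 * (A ^ 8 + 14 * A ^ 4 * B ^ 4 + B ^ 8) := by
  have h8 : s ^ 8 = τ ^ 4 / 16 := by
    rw [show s ^ 8 = (s ^ 2) ^ 4 by ring, hs]
    linear_combination (τ ^ 4 / 16) * I_pow_four
  linear_combination (16 * (A ^ 8 + 14 * A ^ 4 * B ^ 4 + B ^ 8)) * h8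

/-- There are Jacobi forms of index one and every even weight `k ≥ 4` with integral Fourier
coefficients and constant term one, given by polynomials in the theta series
`thetaEven` and `thetaOdd` (Jacobi polynomials of self-dual codes). -/
theorem exists_isJacobiForm {k : ℕ} (hk : 4 ≤ k) (hk2 : Even k) :
    ∃ (c : ℕ → ℤ) (φ : ℂ → ℂ → ℂ), c 0 = 1 ∧ IsJacobiForm k c φ := by
  have A := isQuarterExpansion_thetaEven
  have B := isQuarterExpansion_thetaOdd
  have W := ((A.pow 8).add (((IsQuarterExpansion.intCast 14).mul (A.pow 4)).mul (B.pow 4))).add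
    (B.pow 8)
  have hA0 : (squareSeries fun r ↦ Even r).coeff 0 = 1 := by
    simp [squareSeries]
    decide
  have hB0 : (squareSeries fun r ↦ ¬ Even r).coeff 0 = 0 := by
    simp [squareSeries]
  obtain ⟨j, hj⟩ : ∃ j, k = 4 + 4 * j ∨ k = 6 + 4 * j := by
    obtain ⟨l, rfl⟩ := hk2
    exact ⟨(l - 2) / 2, by omega⟩
  rcases hj with rfl | rfl
  · have f := (W.pow j).mul ((A.pow 7).add (((IsQuarterExpansion.intCast 7).mul (A.pow 3)).mul
      (B.pow 4)))
    have g := (W.pow j).mul ((((IsQuarterExpansion.intCast 7).mul (A.pow 4)).mul (B.pow 3)).add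
      (B.pow 7))
    refine ⟨_, _, ?_, isJacobiForm_of_quarterExpansion (by simpa using f) (by simpa using g) ?_⟩
    · simp [PowerSeries.coeff_zero_eq_constantCoeff] at hA0 hB0 ⊢
      simp [hA0, hB0]
    · intro τ z hτ
      have hA' := thetaEven_neg_inv hτ 0
      have hB' := thetaOdd_neg_inv hτ 0
      have hs := sq_cpow_half (-I * (τ / 2))
      simp only [zero_div, zero_pow two_ne_zero, expTwoPi_zero, mul_one] at hA' hB'
      simp only [thetaEven_neg_inv hτ z, thetaOdd_neg_inv hτ z, hA', hB',
        weightEnumerator_neg_inv hs]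
      have hs8 : ((-I * (τ / 2)) ^ (1 / 2 : ℂ)) ^ 8 = τ ^ 4 / 16 := by
        rw [show ∀ s : ℂ, s ^ 8 = (s ^ 2) ^ 4 from fun s ↦ by ring, hs]
        linear_combination (τ ^ 4 / 16) * I_pow_four
      generalize (-I * (τ / 2)) ^ (1 / 2 : ℂ) = s at hs8
      simp only [mul_pow _ _ j, ← pow_mul]
      generalize thetaEven τ 0 = A
      generalize thetaOdd τ 0 = B
      generalize (A ^ 8 + 14 * A ^ 4 * B ^ 4 + B ^ 8) ^ j = W
      linear_combination (16 * τ ^ (4 * j) * W * expTwoPi (z ^ 2 / τ) *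
        ((A ^ 7 + 7 * A ^ 3 * B ^ 4) * thetaEven τ z + (7 * A ^ 4 * B ^ 3 + B ^ 7) * thetaOdd τ z)) * hs8
  · have hcst (n : ℤ) := IsQuarterExpansion.intCast n
    have f := (W.pow j).mul (((A.pow 11).add (((hcst (-22)).mul (A.pow 7)).mul (B.pow 4))).add
      (((hcst (-11)).mul (A.pow 3)).mul (B.pow 8)))
    have g := (W.pow j).mul (((((hcst (-11)).mul (A.pow 8)).mul (B.pow 3)).add
      (((hcst (-22)).mul (A.pow 4)).mul (B.pow 7))).add (B.pow 11))
    refine ⟨_, _, ?_, isJacobiForm_of_quarterExpansion (by simpa using f) (by simpa using g) ?_⟩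
    · simp [PowerSeries.coeff_zero_eq_constantCoeff] at hA0 hB0 ⊢
      simp [hA0, hB0]
    · intro τ z hτ
      have hA' := thetaEven_neg_inv hτ 0
      have hB' := thetaOdd_neg_inv hτ 0
      have hs := sq_cpow_half (-I * (τ / 2))
      simp only [zero_div, zero_pow two_ne_zero, expTwoPi_zero, mul_one] at hA' hB'
      simp only [thetaEven_neg_inv hτ z, thetaOdd_neg_inv hτ z, hA', hB',
        weightEnumerator_neg_inv hs]
      have hs12 : ((-I * (τ / 2)) ^ (1 / 2 : ℂ)) ^ 12 = -(τ ^ 6 / 64) := by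
        rw [show ∀ s : ℂ, s ^ 12 = (s ^ 2) ^ 6 from fun s ↦ by ring, hs]
        linear_combination (τ ^ 6 / 64 * (I ^ 4 - I ^ 2 + 1)) * I_sq
      generalize (-I * (τ / 2)) ^ (1 / 2 : ℂ) = s at hs12
      simp only [mul_pow _ _ j, ← pow_mul]
      generalize thetaEven τ 0 = A
      generalize thetaOdd τ 0 = B
      generalize (A ^ 8 + 14 * A ^ 4 * B ^ 4 + B ^ 8) ^ j = W
      linear_combination (-64 * τ ^ (4 * j) * W * expTwoPi (z ^ 2 / τ) *
        ((A ^ 11 - 22 * A ^ 7 * B ^ 4 - 11 * A ^ 3 * B ^ 8) * thetaEven τ z +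
          (-11 * A ^ 8 * B ^ 3 - 22 * A ^ 4 * B ^ 7 + B ^ 11) * thetaOdd τ z)) * hs12

/-- The function `(cτ + d)^{-k} e(-mcz²/(cτ + d)) φ(Mτ, mz/(cτ + d))` attached to an integral
matrix `M` with rows `(a, b)`, `(c, d)` and determinant `m`. -/
def jacobiSlash (k : ℕ) (φ : ℂ → ℂ → ℂ) (τ z : ℂ) {m : ℤ} (M : FixedDetMatrix (Fin 2) ℤ m) : ℂ :=
  ((M.1 1 0 * τ + M.1 1 1) ^ k)⁻¹ * expTwoPi (-(m * M.1 1 0 * z ^ 2 / (M.1 1 0 * τ + M.1 1 1))) *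
    φ ((M.1 0 0 * τ + M.1 0 1) / (M.1 1 0 * τ + M.1 1 1)) (m * z / (M.1 1 0 * τ + M.1 1 1))

lemma linear_ne_zero {τ : ℂ} (hτ : 0 < τ.im) {c d : ℤ} (h : c ≠ 0 ∨ d ≠ 0) :
    (c : ℂ) * τ + d ≠ 0 := by
  intro h0
  have him := congrArg Complex.im h0
  simp at him
  rcases him with rfl | h1
  · simp_all
  · exact hτ.ne' h1

lemma im_moebius_pos {τ : ℂ} (hτ : 0 < τ.im) {a b c d : ℤ} (h : 0 < a * d - b * c) :
    0 < (((a : ℂ) * τ + b) / (c * τ + d)).im := by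
  have hne : (c : ℂ) * τ + d ≠ 0 := linear_ne_zero hτ (by
    by_contra! h0
    simp [h0] at h)
  have h1 : (((a : ℂ) * τ + b) / (c * τ + d)).im =
      ((a * d - b * c : ℤ) : ℝ) * τ.im / normSq ((c : ℂ) * τ + d) := by
    rw [Complex.div_im]
    simp
    ring
  rw [h1]
  have h2 : (0 : ℝ) < ((a * d - b * c : ℤ) : ℝ) := by exact_mod_cast h
  have := Complex.normSq_pos.mpr hne
  positivity

section

variable {k : ℕ} {c : ℕ → ℤ} {φ : ℂ → ℂ → ℂ} {m : ℤ} {τ z : ℂ}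

lemma IsJacobiForm.add_one (h : IsJacobiForm k c φ) (hτ : 0 < τ.im) : φ (τ + 1) z = φ τ z := by
  refine (h.hasSum (τ + 1) z (by simpa using hτ)).unique ((h.hasSum τ z hτ).congr_fun fun x ↦ ?_)
  rw [show (x.1 : ℂ) * (τ + 1) + x.2 * z = x.1 + (x.1 * τ + x.2 * z) by ring, expTwoPi_add,
    expTwoPi_int, one_mul]

lemma fixedDet_det (M : FixedDetMatrix (Fin 2) ℤ m) :
    M.1 0 0 * M.1 1 1 - M.1 0 1 * M.1 1 0 = m := by
  rw [← Matrix.det_fin_two]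
  exact M.2

lemma fixedDet_row_ne_zero (hm : 0 < m) (M : FixedDetMatrix (Fin 2) ℤ m) (i : Fin 2) :
    M.1 i 0 ≠ 0 ∨ M.1 i 1 ≠ 0 := by
  have h := fixedDet_det M
  by_contra! h0
  fin_cases i <;> simp_all

lemma IsJacobiForm.jacobiSlash_S_smul (h : IsJacobiForm k c φ) (hm : 0 < m) (hτ : 0 < τ.im)
    (M : FixedDetMatrix (Fin 2) ℤ m) :
    jacobiSlash k φ τ z (ModularGroup.S • M) = jacobiSlash k φ τ z M := by
  have h0 := linear_ne_zero hτ (fixedDet_row_ne_zero hm M 0)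
  have h1 := linear_ne_zero hτ (fixedDet_row_ne_zero hm M 1)
  have hdet := fixedDet_det M
  have him := im_moebius_pos hτ (hdet ▸ hm)
  have hdetC : (M.1 0 0 : ℂ) * M.1 1 1 - M.1 0 1 * M.1 1 0 = m := by exact_mod_cast hdet
  simp only [jacobiSlash, FixedDetMatrices.smul_coe, ModularGroup.coe_S, Matrix.mul_apply,
    Fin.sum_univ_two, Matrix.of_apply, Matrix.cons_val', Matrix.cons_val_zero, Matrix.cons_val_one,
    Matrix.cons_val_fin_one, zero_mul, one_mul, zero_add, add_zero, neg_mul, Int.cast_neg]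
  generalize (M.1 0 0 : ℂ) = a at *
  generalize (M.1 0 1 : ℂ) = b at *
  generalize (M.1 1 0 : ℂ) = u at *
  generalize (M.1 1 1 : ℂ) = d at *
  have h2 := h.neg_inv ((a * τ + b) / (u * τ + d)) (m * z / (u * τ + d)) him
  rw [show -1 / ((a * τ + b) / (u * τ + d)) = (-(u * τ) + -d) / (a * τ + b) by field_simp; ring,
    show m * z / (u * τ + d) / ((a * τ + b) / (u * τ + d)) = m * z / (a * τ + b) by
      field_simp] at h2
  rw [h2, show -(m * u * z ^ 2 / (u * τ + d)) = -(m * a * z ^ 2 / (a * τ + b)) +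
    (m * z / (u * τ + d)) ^ 2 / ((a * τ + b) / (u * τ + d)) by
      rw [← hdetC]; field_simp; ring, expTwoPi_add, div_pow]
  field_simp

lemma IsJacobiForm.jacobiSlash_T_smul (h : IsJacobiForm k c φ) (hm : 0 < m) (hτ : 0 < τ.im)
    (M : FixedDetMatrix (Fin 2) ℤ m) :
    jacobiSlash k φ τ z (ModularGroup.T • M) = jacobiSlash k φ τ z M := by
  have h1 := linear_ne_zero hτ (fixedDet_row_ne_zero hm M 1)
  have him := im_moebius_pos hτ (fixedDet_det M ▸ hm)
  simp only [jacobiSlash, FixedDetMatrices.smul_coe, ModularGroup.coe_T, Matrix.mul_apply,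
    Fin.sum_univ_two, Matrix.of_apply, Matrix.cons_val', Matrix.cons_val_zero, Matrix.cons_val_one,
    Matrix.cons_val_fin_one, zero_mul, one_mul, zero_add, Int.cast_add]
  rw [← h.add_one him]
  congr 2
  field_simp
  ring

lemma IsJacobiForm.jacobiSlash_smul (h : IsJacobiForm k c φ) (hm : 0 < m) (hτ : 0 < τ.im)
    (g : SpecialLinearGroup (Fin 2) ℤ) (M : FixedDetMatrix (Fin 2) ℤ m) :
    jacobiSlash k φ τ z (g • M) = jacobiSlash k φ τ z M := by
  have hg : g ∈ Subgroup.closure {ModularGroup.S, ModularGroup.T} := by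
    rw [SpecialLinearGroup.SL2Z_generators]
    trivial
  induction hg using Subgroup.closure_induction generalizing M with
  | mem g hg =>
    rcases hg with rfl | rfl
    exacts [h.jacobiSlash_S_smul hm hτ M, h.jacobiSlash_T_smul hm hτ M]
  | one => rw [one_smul]
  | mul g g' _ _ hg hg' => rw [mul_smul, hg, hg']
  | inv g _ hg => rw [← hg, smul_inv_smul]

/-- Right multiplication by `S` on the integral matrices of determinant `m`. -/
def FixedDetMatrix.mulS (M : FixedDetMatrix (Fin 2) ℤ m) : FixedDetMatrix (Fin 2) ℤ m :=
  ⟨M.1 * ModularGroup.S, by rw [det_mul, M.2, Matrix.SpecialLinearGroup.det_coe, mul_one]⟩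

lemma jacobiSlash_neg_inv (hm : 0 < m) (hτ : 0 < τ.im) (M : FixedDetMatrix (Fin 2) ℤ m) :
    jacobiSlash k φ (-1 / τ) (z / τ) M =
      τ ^ k * expTwoPi (m * (z ^ 2 / τ)) * jacobiSlash k φ τ z M.mulS := by
  have hτ0 : τ ≠ 0 := by rintro rfl; simp at hτ
  have h1 := linear_ne_zero hτ (c := M.1 1 1) (d := -M.1 1 0) (by
    rw [neg_ne_zero]
    exact (fixedDet_row_ne_zero hm M 1).symm)
  simp only [jacobiSlash, FixedDetMatrix.mulS, ModularGroup.coe_S, Matrix.mul_apply,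
    Fin.sum_univ_two, Matrix.of_apply, Matrix.cons_val', Matrix.cons_val_zero, Matrix.cons_val_one,
    Matrix.cons_val_fin_one, mul_zero, mul_one, zero_add, add_zero, mul_neg, Int.cast_neg] at h1 ⊢
  generalize (M.1 0 0 : ℂ) = a at *
  generalize (M.1 0 1 : ℂ) = b at *
  generalize (M.1 1 0 : ℂ) = u at *
  generalize (M.1 1 1 : ℂ) = d at *
  obtain ⟨v, rfl⟩ : ∃ v, u = d * τ - v := ⟨d * τ - u, by ring⟩
  rw [show d * τ + -(d * τ - v) = v by ring] at h1 ⊢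
  rw [show (d * τ - v) * (-1 / τ) + d = v / τ by field_simp; ring,
    show (a * (-1 / τ) + b) / (v / τ) = (b * τ + -a) / v by field_simp; ring,
    show m * (z / τ) / (v / τ) = m * z / v by field_simp,
    show -(m * (d * τ - v) * (z / τ) ^ 2 / (v / τ)) =
      m * (z ^ 2 / τ) + -(m * d * z ^ 2 / v) by field_simp; ring, expTwoPi_add, div_pow]
  field_simp

/-- The upper triangular matrices with rows `(a, b)`, `(0, d)`, where `ad = m` and `0 ≤ b < d`. -/
def triangularRep (m : ℕ) (x : (y : m.divisorsAntidiagonal) × Fin y.1.2) :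
    FixedDetMatrix (Fin 2) ℤ m :=
  ⟨!![(x.1.1.1 : ℤ), ((x.2 : ℕ) : ℤ); 0, (x.1.1.2 : ℤ)], by
    have h := (Nat.mem_divisorsAntidiagonal.mp x.1.2).1
    rw [Matrix.det_fin_two_of]
    rw [mul_zero, sub_zero]
    exact_mod_cast h⟩

/-- The `SL₂(ℤ)`-orbits of integral matrices of determinant `m`. -/
abbrev detOrbits (m : ℤ) : Type :=
  MulAction.orbitRel.Quotient (SpecialLinearGroup (Fin 2) ℤ) (FixedDetMatrix (Fin 2) ℤ m)

lemma triangularRep_injective (m : ℕ) :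
    Function.Injective fun x ↦ (Quotient.mk'' (triangularRep m x) : detOrbits m) := by
  rintro ⟨⟨⟨a, d⟩, hx⟩, b⟩ ⟨⟨⟨a', d'⟩, hx'⟩, b'⟩ h
  obtain ⟨g, hg⟩ := Quotient.exact h
  have hg : g.1 * (triangularRep m ⟨⟨(a', d'), hx'⟩, b'⟩).1 =
      (triangularRep m ⟨⟨(a, d), hx⟩, b⟩).1 := congrArg Subtype.val hg
  have hdet : g.1 0 0 * g.1 1 1 - g.1 0 1 * g.1 1 0 = 1 := by
    rw [← Matrix.det_fin_two]
    exact g.2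
  have hent (i j : Fin 2) := congrFun₂ hg i j
  have h00 := hent 0 0
  have h01 := hent 0 1
  have h10 := hent 1 0
  have h11 := hent 1 1
  simp [triangularRep, Matrix.mul_apply] at h00 h01 h10 h11
  obtain ⟨hx1, hm⟩ := Nat.mem_divisorsAntidiagonal.mp hx
  obtain ⟨hx2, -⟩ := Nat.mem_divisorsAntidiagonal.mp hx'
  have ha : 0 < a := Nat.pos_of_ne_zero fun h0 ↦ by simp_all
  have ha' : 0 < a' := Nat.pos_of_ne_zero fun h0 ↦ by simp_all
  have h10 : g.1 1 0 = 0 := h10.resolve_right ha'.ne'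
  rw [h10, mul_zero, sub_zero] at hdet
  have hg0 : 0 < g.1 0 0 := by
    by_contra! h0
    nlinarith [mul_nonneg (sub_nonneg.mpr h0) (Int.natCast_nonneg a')]
  have hg1 : g.1 0 0 = 1 := Int.eq_one_of_mul_eq_one_right hg0.le hdet
  have hg2 : g.1 1 1 = 1 := by simpa [hg1] using hdet
  rw [hg1, one_mul] at h00 h01
  rw [h10, hg2, zero_mul, one_mul, zero_add] at h11
  have h00 : a' = a := by exact_mod_cast h00
  have h11 : d' = d := by exact_mod_cast h11
  subst h00 h11
  have hb := b.2
  have hb' := b'.2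
  simp only at hb hb'
  have hg3 : g.1 0 1 = 0 := by
    by_contra h0
    rcases lt_or_gt_of_ne h0 with h0 | h0 <;> nlinarith
  rw [hg3, zero_mul, add_zero] at h01
  have h01 : b' = b := Fin.ext (by exact_mod_cast h01)
  rw [h01]

lemma triangularRep_surjective {m : ℕ} (hm : m ≠ 0) :
    Function.Surjective fun x ↦ (Quotient.mk'' (triangularRep m x) : detOrbits m) := by
  intro q
  induction q using Quotient.inductionOn' with | h A
  have hsmul (g : SpecialLinearGroup (Fin 2) ℤ) (B : FixedDetMatrix (Fin 2) ℤ m) :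
      (Quotient.mk'' (g • B) : detOrbits m) = Quotient.mk'' B := Quotient.sound ⟨g, rfl⟩
  have hmZ : (m : ℤ) ≠ 0 := by exact_mod_cast hm
  induction A using FixedDetMatrices.induction_on hmZ with
  | hS B hB => simpa only [hsmul] using hB
  | hT B hB => simpa only [hsmul] using hB
  | h0 A h10 h00 h01 h11 =>
    have hdet := fixedDet_det A
    rw [h10, mul_zero, sub_zero] at hdet
    have hd : 0 < A.1 1 1 := pos_of_mul_pos_right (a := A.1 0 0) (by rw [hdet]; positivity) h00.le
    rw [abs_of_nonneg h01, abs_of_pos hd] at h11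
    refine ⟨⟨⟨((A.1 0 0).toNat, (A.1 1 1).toNat), ?_⟩, ⟨(A.1 0 1).toNat, ?_⟩⟩, ?_⟩
    · refine Nat.mem_divisorsAntidiagonal.mpr ⟨?_, hm⟩
      zify
      rw [Int.toNat_of_nonneg h00.le, Int.toNat_of_nonneg hd.le, hdet]
    · simp only
      omega
    · refine congrArg Quotient.mk'' (FixedDetMatrices.ext _ _ fun i j ↦ ?_)
      fin_cases i <;> fin_cases j <;> simp [triangularRep, h10, h01, h00.le, hd.le]

/-- The equivalence between triangular representatives and orbits. -/
def triangularEquiv {m : ℕ} (hm : m ≠ 0) :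
    ((y : m.divisorsAntidiagonal) × Fin y.1.2) ≃ detOrbits m :=
  Equiv.ofBijective _ ⟨triangularRep_injective m, triangularRep_surjective hm⟩

lemma FixedDetMatrix.mulS_smul (g : SpecialLinearGroup (Fin 2) ℤ)
    (A : FixedDetMatrix (Fin 2) ℤ m) : (g • A).mulS = g • A.mulS :=
  FixedDetMatrices.ext' _ _ (Matrix.mul_assoc _ _ _)

/-- The self-map of the set of orbits induced by right multiplication by `S`. -/
def orbitMulS (m : ℤ) : detOrbits m → detOrbits m :=
  Quotient.map' FixedDetMatrix.mulS (by
    rintro A B ⟨g, rfl⟩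
    exact ⟨g, (FixedDetMatrix.mulS_smul g B).symm⟩)

lemma orbitMulS_injective (m : ℤ) : Function.Injective (orbitMulS m) := by
  intro q q' h
  induction q using Quotient.inductionOn' with | h A
  induction q' using Quotient.inductionOn' with | h B
  obtain ⟨g, hg⟩ := Quotient.exact h
  refine Quotient.sound ⟨g, FixedDetMatrices.ext' _ _ ?_⟩
  have h1 : g.1 * B.1 * ModularGroup.S.1 = A.1 * ModularGroup.S.1 :=
    (Matrix.mul_assoc _ _ _).trans (congrArg Subtype.val hg)
  have h2 := congrArg (· * (ModularGroup.S⁻¹ : Matrix.SpecialLinearGroup (Fin 2) ℤ).1) h1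
  have h3 : ModularGroup.S.1 * (ModularGroup.S⁻¹ : Matrix.SpecialLinearGroup (Fin 2) ℤ).1 = 1 :=
    congrArg Subtype.val (mul_inv_cancel ModularGroup.S)
  have h4 : g.1 * B.1 = A.1 := by simpa only [Matrix.mul_assoc, h3, Matrix.mul_one] using h2
  exact h4

/-- The image of `φ` under the Hecke operator `V_m`. -/
def heckeV (k : ℕ) (φ : ℂ → ℂ → ℂ) (m : ℕ) (τ z : ℂ) : ℂ :=
  ∑ x ∈ m.divisorsAntidiagonal, ∑ b ∈ Finset.range x.2,
    (x.1 : ℂ) ^ (k - 1) * (x.2 : ℂ)⁻¹ * φ ((x.1 * τ + b) / x.2) (x.1 * z)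

lemma heckeV_eq_sum_jacobiSlash {m : ℕ} (hk : k ≠ 0) :
    heckeV k φ m τ z = m ^ (k - 1) * ∑ x, jacobiSlash k φ τ z (triangularRep m x) := by
  rw [heckeV, Fintype.sum_sigma, ← Finset.sum_coe_sort, Finset.mul_sum]
  refine Finset.sum_congr rfl fun y _ ↦ ?_
  rw [Finset.sum_range, Finset.mul_sum]
  refine Finset.sum_congr rfl fun b _ ↦ ?_
  obtain ⟨⟨a, d⟩, hy⟩ := y
  obtain ⟨hy, hm⟩ := Nat.mem_divisorsAntidiagonal.mp hy
  have hd : (d : ℂ) ≠ 0 := by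
    rintro h
    simp_all
  have hyC : (m : ℂ) = a * d := by exact_mod_cast hy.symm
  obtain ⟨l, rfl⟩ := Nat.exists_eq_succ_of_ne_zero hk
  simp [jacobiSlash, triangularRep, expTwoPi_zero, hyC]
  rw [show (a : ℂ) * d * z / d = a * z by field_simp, mul_pow, pow_succ]
  field_simp

lemma IsJacobiForm.heckeV_neg_inv (h : IsJacobiForm k c φ) (hk : k ≠ 0) {m : ℕ} (hm : m ≠ 0)
    (hτ : 0 < τ.im) : heckeV k φ m (-1 / τ) (z / τ) =
      τ ^ k * expTwoPi (m * (z ^ 2 / τ)) * heckeV k φ m τ z := by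
  have hm' : (0 : ℤ) < m := by positivity
  let e := triangularEquiv hm
  have : Fintype (detOrbits m) := Fintype.ofEquiv _ e
  let F : detOrbits m → ℂ := fun q ↦ Quotient.liftOn' q (jacobiSlash k φ τ z) (by
    rintro A B ⟨g, rfl⟩
    exact h.jacobiSlash_smul hm' hτ g B)
  have hbij := Finite.injective_iff_bijective.mp (orbitMulS_injective m)
  have h1 : ∑ x, jacobiSlash k φ τ z (triangularRep m x) = ∑ q, F q :=
    Fintype.sum_equiv e _ _ fun x ↦ rfl
  have h2 : ∑ x, jacobiSlash k φ τ z (triangularRep m x).mulS = ∑ q, F (orbitMulS m q) :=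
    Fintype.sum_equiv e _ _ fun x ↦ rfl
  rw [heckeV_eq_sum_jacobiSlash hk, heckeV_eq_sum_jacobiSlash hk]
  simp only [jacobiSlash_neg_inv hm' hτ]
  rw [← Finset.mul_sum, h2, Function.Bijective.sum_comp hbij, h1]
  push_cast
  ring

end

/-- The Fourier coefficient at `(n, r, m)` of the Maass lift of the Jacobi form with coefficients
`c (4n - r²)`. -/
def maassCoeff (k : ℕ) (c : ℕ → ℤ) (n r m : ℤ) : ℤ :=
  ∑ d ∈ (Int.gcd n (Int.gcd r m)).divisors,
    (d : ℤ) ^ (k - 1) * extendZero c ((4 * n * m - r ^ 2) / (d : ℤ) ^ 2)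

lemma sum_expTwoPi_mul_div {d : ℕ} (hd : d ≠ 0) (n : ℤ) :
    ∑ b ∈ Finset.range d, expTwoPi (n * b / d) = if (d : ℤ) ∣ n then (d : ℂ) else 0 := by
  have hdC : (d : ℂ) ≠ 0 := by exact_mod_cast hd
  have h1 (b : ℕ) : expTwoPi (n * b / d) = expTwoPi (n / d) ^ b := by
    rw [← expTwoPi_natCast_mul]
    ring_nf
  simp only [h1]
  split_ifs with h
  · obtain ⟨l, rfl⟩ := h
    rw [show (((d : ℤ) * l : ℤ) : ℂ) / d = l by push_cast; field_simp, expTwoPi_int]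
    simp
  · have hne : expTwoPi (n / d) ≠ 1 := by
      intro h2
      obtain ⟨l, hl⟩ := Complex.exp_eq_one_iff.mp h2
      have hpi : (2 * Real.pi * I : ℂ) ≠ 0 := Complex.two_pi_I_ne_zero
      have h3 : (n : ℂ) / d = l := mul_left_cancel₀ hpi (by rw [hl]; ring)
      rw [div_eq_iff hdC] at h3
      exact h ⟨l, by rw [mul_comm]; exact_mod_cast h3⟩
    rw [geom_sum_eq hne, ← expTwoPi_natCast_mul, mul_div_cancel₀ _ hdC, expTwoPi_int]
    simp

section

variable {k : ℕ} {c : ℕ → ℤ} {φ : ℂ → ℂ → ℂ} {τ z : ℂ}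

lemma IsJacobiForm.hasSum_translates (h : IsJacobiForm k c φ) (hτ : 0 < τ.im) {a d : ℕ}
    (ha : a ≠ 0) (hd : d ≠ 0) :
    HasSum (fun x : ℤ × ℤ ↦ if (a : ℤ) ∣ x.1 ∧ (a : ℤ) ∣ x.2 then
        ((a : ℂ) ^ (k - 1) * extendZero c ((4 * x.1 * (a * d : ℕ) - x.2 ^ 2) / (a : ℤ) ^ 2)) *
          expTwoPi (x.1 * τ + x.2 * z) else 0)
      (∑ b ∈ Finset.range d, (a : ℂ) ^ (k - 1) * (d : ℂ)⁻¹ * φ ((a * τ + b) / d) (a * z)) := by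
  have hdC : (d : ℂ) ≠ 0 := by exact_mod_cast hd
  have haZ : (a : ℤ) ≠ 0 := by exact_mod_cast ha
  have hdZ : (d : ℤ) ≠ 0 := by exact_mod_cast hd
  have him (b : ℕ) : 0 < ((a * τ + b) / d : ℂ).im := by
    have := im_moebius_pos hτ (a := a) (b := b) (c := 0) (d := d) (by
      rw [mul_zero, sub_zero]
      positivity)
    simpa using this
  have h1 := hasSum_sum fun b (_ : b ∈ Finset.range d) ↦
    ((h.hasSum _ (a * z) (him b)).mul_left ((a : ℂ) ^ (k - 1) * (d : ℂ)⁻¹))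
  have hinj : Function.Injective fun x : ℤ × ℤ ↦ (d * x.1, x.2) := by
    rintro ⟨x, y⟩ ⟨x', y'⟩ hxy
    simpa [hd] using hxy
  have hinj' : Function.Injective fun x : ℤ × ℤ ↦ (a * x.1, a * x.2) := by
    rintro ⟨x, y⟩ ⟨x', y'⟩ hxy
    simpa [ha] using hxy
  have h2 (x : ℤ × ℤ) : ∑ b ∈ Finset.range d, (a : ℂ) ^ (k - 1) * (d : ℂ)⁻¹ *
      ((extendZero c (4 * x.1 - x.2 ^ 2) : ℂ) *
        expTwoPi (x.1 * ((a * τ + b) / d) + x.2 * (a * z))) =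
      if (d : ℤ) ∣ x.1 then (a : ℂ) ^ (k - 1) * ((extendZero c (4 * x.1 - x.2 ^ 2) : ℂ) *
        expTwoPi (x.1 * (a * τ / d) + x.2 * (a * z))) else 0 := by
    have h3 (b : ℕ) : expTwoPi (x.1 * ((a * τ + b) / d) + x.2 * (a * z)) =
        expTwoPi (x.1 * (a * τ / d) + x.2 * (a * z)) * expTwoPi (x.1 * b / d) := by
      rw [← expTwoPi_add]
      ring_nf
    simp only [h3]
    simp only [← mul_assoc (_ ^ (k - 1) * _), ← mul_assoc (_ * _ * _) (expTwoPi _)]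
    rw [← Finset.mul_sum, sum_expTwoPi_mul_div hd]
    split_ifs
    · field_simp
    · rw [mul_zero]
  simp only [h2] at h1
  rw [← hinj.hasSum_iff] at h1
  · rw [← hinj'.hasSum_iff]
    · refine h1.congr_fun fun x ↦ ?_
      simp only [Function.comp, dvd_mul_right, and_self, if_true]
      rw [show (4 * (a * x.1) * (a * d : ℕ) - (a * x.2) ^ 2 : ℤ) / (a : ℤ) ^ 2 =
        4 * (d * x.1) - x.2 ^ 2 by
          refine Int.ediv_eq_of_eq_mul_right (by positivity) ?_
          push_cast
          ring, mul_assoc]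
      congr 3
      push_cast
      field_simp
    · rintro ⟨x, y⟩ hx
      refine if_neg ?_
      rintro ⟨⟨x', hx'⟩, ⟨y', hy'⟩⟩
      exact hx ⟨(x', y'), by simp_all⟩
  · rintro ⟨x, y⟩ hx
    refine if_neg ?_
    rintro ⟨x', hx'⟩
    exact hx ⟨(x', y), by simp_all⟩

lemma divisors_gcd_eq_filter {m : ℕ} (hm : m ≠ 0) (n r : ℤ) :
    (Int.gcd n (Int.gcd r m)).divisors = m.divisors.filter fun d : ℕ ↦ (d : ℤ) ∣ n ∧ (d : ℤ) ∣ r := by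
  ext d
  have hne : Int.gcd n (Int.gcd r m) ≠ 0 := by simp [Int.gcd_eq_zero_iff, hm]
  simp only [Nat.mem_divisors, Finset.mem_filter, ← Int.natCast_dvd_natCast,
    Int.dvd_coe_gcd_iff]
  tauto

lemma IsJacobiForm.hasSum_heckeV (h : IsJacobiForm k c φ) (hτ : 0 < τ.im) {m : ℕ} (hm : m ≠ 0) :
    HasSum (fun x : ℤ × ℤ ↦ (maassCoeff k c x.1 x.2 m : ℂ) * expTwoPi (x.1 * τ + x.2 * z))
      (heckeV k φ m τ z) := by
  have h1 : HasSum _ (heckeV k φ m τ z) := hasSum_sum fun x (hx : x ∈ m.divisorsAntidiagonal) ↦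
    h.hasSum_translates (z := z) hτ (a := x.1) (d := x.2) (fun h0 ↦ by simp_all)
      (fun h0 ↦ by simp_all)
  refine h1.congr_fun fun x ↦ ?_
  have h2 : ∀ y ∈ m.divisorsAntidiagonal, (if (y.1 : ℤ) ∣ x.1 ∧ (y.1 : ℤ) ∣ x.2 then
        ((y.1 : ℂ) ^ (k - 1) * extendZero c ((4 * x.1 * (y.1 * y.2 : ℕ) - x.2 ^ 2) /
          (y.1 : ℤ) ^ 2)) * expTwoPi (x.1 * τ + x.2 * z) else 0) =
      (fun a : ℕ ↦ if (a : ℤ) ∣ x.1 ∧ (a : ℤ) ∣ x.2 then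
        ((a : ℂ) ^ (k - 1) * extendZero c ((4 * x.1 * m - x.2 ^ 2) / (a : ℤ) ^ 2)) *
          expTwoPi (x.1 * τ + x.2 * z) else 0) y.1 := by
    intro y hy
    rw [(Nat.mem_divisorsAntidiagonal.mp hy).1]
  rw [Finset.sum_congr rfl h2, Nat.sum_divisorsAntidiagonal fun a _ ↦
    (fun a : ℕ ↦ if (a : ℤ) ∣ x.1 ∧ (a : ℤ) ∣ x.2 then
      ((a : ℂ) ^ (k - 1) * extendZero c ((4 * x.1 * m - x.2 ^ 2) / (a : ℤ) ^ 2)) *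
        expTwoPi (x.1 * τ + x.2 * z) else 0) a, ← Finset.sum_filter,
    ← divisors_gcd_eq_filter hm, ← Finset.sum_mul, maassCoeff]
  push_cast
  rfl

end

open EisensteinSeries ModularFormClass in
lemma exists_eisenstein {k : ℕ} (hk : 4 ≤ k) (hk2 : Even k) : ∃ g : ℂ → ℂ,
    (∀ τ : ℂ, 0 < τ.im → HasSum (fun n : ℕ ↦ (if n = 0 then 1 else
      -(2 * k / bernoulli k : ℂ) * ArithmeticFunction.sigma (k - 1) n) * expTwoPi τ ^ n) (g τ)) ∧
    ∀ τ : ℂ, 0 < τ.im → g (-1 / τ) = τ ^ k * g τ := by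
  have hk3 : 3 ≤ k := by omega
  refine ⟨fun τ ↦ if h : 0 < τ.im then ModularForm.E hk3 ⟨τ, h⟩ else 0, fun τ hτ ↦ ?_,
    fun τ hτ ↦ ?_⟩
  · have h := ModularForm.hasSum_qExpansion (f := ModularForm.E hk3) one_pos
      one_mem_strictPeriods_SL ⟨τ, hτ⟩
    simp only [E_qExpansion_coeff hk3 hk2] at h
    simp only [dif_pos hτ]
    refine h.congr_fun fun n ↦ ?_
    congr 2
    simp [expTwoPi, Function.Periodic.qParam]
  · have him : 0 < (-1 / τ).im := by
      have := im_moebius_pos hτ (a := 0) (b := -1) (c := 1) (d := 0) (by norm_num)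
      simpa using this
    have h := SlashInvariantForm.slash_action_eqn'' (ModularForm.E hk3)
      (γ := ModularGroup.S) (MonoidHom.mem_range.mpr ⟨ModularGroup.S, rfl⟩) ⟨τ, hτ⟩
    simp only [dif_pos hτ, dif_pos him]
    have h2 : (⟨-1 / τ, him⟩ : UpperHalfPlane) =
      (ModularGroup.S : Matrix.SpecialLinearGroup (Fin 2) ℤ) • (⟨τ, hτ⟩ : UpperHalfPlane) := by
      rw [UpperHalfPlane.modular_S_smul]
      ext
      simp [neg_div]
    rw [h2]
    refine h.trans ?_
    rw [← zpow_natCast]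
    congr 2
    exact ModularGroup.denom_S _

/-- The Fourier coefficients of the Maass lift with constant term one, where `x = (m, n, r)`
stands for the quadratic form `nX² + rXY + mY²`. -/
def liftCoeff (β : ℂ) (k : ℕ) (c : ℕ → ℤ) (x : ℤ × ℤ × ℤ) : ℂ :=
  if 0 ≤ x.2.1 ∧ 0 ≤ x.1 ∧ x.2.2 ^ 2 ≤ 4 * x.2.1 * x.1 then
    if x.2.1 = 0 ∧ x.1 = 0 then 1 else β * maassCoeff k c x.2.1 x.2.2 x.1 else 0

lemma extendZero_neg (c : ℕ → ℤ) {D : ℤ} (hD : D < 0) : extendZero c D = 0 :=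
  if_neg (not_le.mpr hD)

section

variable {k : ℕ} {c : ℕ → ℤ}

lemma maassCoeff_eq_zero {n r m : ℤ} (h : 4 * n * m < r ^ 2) : maassCoeff k c n r m = 0 := by
  refine Finset.sum_eq_zero fun d hd ↦ ?_
  have hd0 : (0 : ℤ) < d := by exact_mod_cast Nat.pos_of_mem_divisors hd
  rw [extendZero_neg _ (Int.ediv_neg_of_neg_of_pos (by linarith) (by positivity)), mul_zero]

lemma liftCoeff_of_pos (β : ℂ) {n r m : ℤ} (hm : 0 < m) :
    liftCoeff β k c (m, n, r) = β * maassCoeff k c n r m := by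
  rw [liftCoeff]
  split_ifs with h h0
  · exact absurd h0.2 hm.ne'
  · rfl
  · rw [maassCoeff_eq_zero]
    · simp
    · by_contra! h1
      exact h ⟨by nlinarith [sq_nonneg r], hm.le, h1⟩

lemma liftCoeff_zero_left (hc : c 0 = 1) (β : ℂ) (n : ℕ) :
    liftCoeff β k c (0, n, 0) =
      if n = 0 then 1 else β * ArithmeticFunction.sigma (k - 1) n := by
  rw [liftCoeff, if_pos (by simp)]
  simp only [Nat.cast_eq_zero, and_true]
  congr 2
  simp [maassCoeff, extendZero, hc, ArithmeticFunction.sigma_apply]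

lemma exists_fourierJacobi {φ : ℂ → ℂ → ℂ} (h : IsJacobiForm k c φ) (hc : c 0 = 1) (hk : 4 ≤ k)
    (hk2 : Even k) : ∃ g : ℤ → ℂ → ℂ → ℂ, ∀ m τ z, 0 < τ.im →
      HasSum (fun x ↦ liftCoeff (-(2 * k / bernoulli k : ℂ)) k c (m, x) *
        expTwoPi (x.1 * τ + x.2 * z)) (g m τ z) ∧
      g m (-1 / τ) (z / τ) = τ ^ k * expTwoPi (m * (z ^ 2 / τ)) * g m τ z := by
  obtain ⟨E, hE, hE'⟩ := exists_eisenstein hk hk2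
  set β := -(2 * k / bernoulli k : ℂ)
  refine ⟨fun m τ z ↦ if m < 0 then 0 else if m = 0 then E τ else β * heckeV k φ m.toNat τ z,
    fun m τ z hτ ↦ ?_⟩
  rcases lt_trichotomy m 0 with hm | rfl | hm
  · simp only [hm, if_true, mul_zero, and_true]
    refine hasSum_zero.congr_fun fun x ↦ ?_
    rw [liftCoeff, if_neg (fun h ↦ absurd h.2.1 (not_le.mpr hm)), zero_mul]
  · simp only [lt_irrefl, if_false, if_true, hE' τ hτ, Int.cast_zero, zero_mul, expTwoPi_zero,
      mul_one, and_true]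
    have hinj : Function.Injective fun n : ℕ ↦ ((n : ℤ), (0 : ℤ)) := fun a b hab ↦ by simpa using hab
    rw [← hinj.hasSum_iff]
    · refine (hE τ hτ).congr_fun fun n ↦ ?_
      simp only [Function.comp]
      rw [liftCoeff_zero_left hc, ← expTwoPi_natCast_mul]
      simp
    · rintro ⟨n, r⟩ hx
      rw [liftCoeff, if_neg, zero_mul]
      rintro ⟨hn, -, hr⟩
      simp only [mul_zero] at hr
      have hr : r = 0 := by nlinarith [sq_nonneg r]
      exact hx ⟨n.toNat, by simp [hr, hn]⟩
  · obtain ⟨m, rfl⟩ := Int.eq_ofNat_of_zero_le hm.le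
    have hm0 : m ≠ 0 := by omega
    simp only [hm.ne', not_lt.mpr hm.le, if_false, Int.toNat_natCast]
    refine ⟨?_, ?_⟩
    · refine ((h.hasSum_heckeV hτ hm0).mul_left β).congr_fun fun x ↦ ?_
      rw [liftCoeff_of_pos _ hm, mul_assoc]
    · rw [h.heckeV_neg_inv (by omega) hm0 hτ]
      push_cast
      ring

end

lemma HasPolyGrowth.exists_maassCoeff_le {c : ℕ → ℤ} (hc : HasPolyGrowth c) (k : ℕ) :
    ∃ C K : ℕ, ∀ n r m : ℤ, 0 ≤ n → 0 ≤ m → r ^ 2 ≤ 4 * n * m → ¬(n = 0 ∧ m = 0) →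
      |maassCoeff k c n r m| ≤ C * (n + m + 1) ^ K := by
  obtain ⟨C, K, h⟩ := hc
  refine ⟨C, 1 + (k - 1) + 2 * K, fun n r m hn hm hr hne ↦ ?_⟩
  set s := n + m with hs
  have hs0 : 0 ≤ s := by positivity
  set g := Int.gcd n (Int.gcd r m)
  have hg : (g : ℤ) ≤ s := by
    have h1 : (g : ℤ) ∣ n := Int.gcd_dvd_left ..
    have h2 : (g : ℤ) ∣ m := (Int.gcd_dvd_right ..).trans (Int.gcd_dvd_right ..)
    exact Int.le_of_dvd (by omega) (dvd_add h1 h2)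
  have hterm : ∀ d ∈ g.divisors, |(d : ℤ) ^ (k - 1) *
      extendZero c ((4 * n * m - r ^ 2) / (d : ℤ) ^ 2)| ≤
        (s + 1) ^ (k - 1) * (C * ((s + 1) ^ 2) ^ K) := by
    intro d hd
    have hd1 : (d : ℤ) ≤ s := le_trans (by exact_mod_cast Nat.divisor_le hd) hg
    have hd0 : (0 : ℤ) < d := by exact_mod_cast Nat.pos_of_mem_divisors hd
    have hD : 0 ≤ 4 * n * m - r ^ 2 := by linarith
    have hq : 0 ≤ (4 * n * m - r ^ 2) / (d : ℤ) ^ 2 := Int.ediv_nonneg hD (by positivity)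
    have hq2 : (4 * n * m - r ^ 2) / (d : ℤ) ^ 2 ≤ 4 * n * m - r ^ 2 :=
      Int.ediv_le_self _ hD
    rw [abs_mul, extendZero, if_pos hq, abs_of_nonneg (pow_nonneg hd0.le _)]
    have h3 := h ((4 * n * m - r ^ 2) / (d : ℤ) ^ 2).toNat
    rw [Int.toNat_of_nonneg hq] at h3
    have h4 : (4 * n * m - r ^ 2) / (d : ℤ) ^ 2 + 1 ≤ (s + 1) ^ 2 := by
      nlinarith [sq_nonneg (n - m), sq_nonneg r]
    gcongr
    · linarith
    · exact h3.trans (by gcongr)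
  calc |maassCoeff k c n r m| ≤ ∑ d ∈ g.divisors, |(d : ℤ) ^ (k - 1) *
      extendZero c ((4 * n * m - r ^ 2) / (d : ℤ) ^ 2)| := Finset.abs_sum_le_sum_abs _ _
    _ ≤ g.divisors.card • ((s + 1) ^ (k - 1) * (C * ((s + 1) ^ 2) ^ K)) :=
      Finset.sum_le_card_nsmul _ _ _ hterm
    _ ≤ (s + 1) * ((s + 1) ^ (k - 1) * (C * ((s + 1) ^ 2) ^ K)) := by
      rw [nsmul_eq_mul]
      have h5 : (g.divisors.card : ℤ) ≤ g := by exact_mod_cast Nat.card_divisors_le_self g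
      gcongr
      linarith
    _ = _ := by
      rw [← pow_mul]
      ring

/-- A family of coefficients indexed by binary quadratic forms `x = (m, n, r)` which is supported
on semidefinite forms and has polynomial growth. -/
structure IsModerate (a : ℤ × ℤ × ℤ → ℂ) : Prop where
  support : ∀ x, a x ≠ 0 → 0 ≤ x.2.1 ∧ 0 ≤ x.1 ∧ x.2.2 ^ 2 ≤ 4 * x.2.1 * x.1
  growth : ∃ C K : ℕ, ∀ x, a x ≠ 0 → ‖a x‖ ≤ C * ((x.2.1 : ℝ) + x.1 + 1) ^ K

lemma isModerate_liftCoeff {c : ℕ → ℤ} (hc : HasPolyGrowth c) (β : ℂ) (k : ℕ) :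
    IsModerate (liftCoeff β k c) where
  support x hx := by
    by_contra h
    exact hx (if_neg h)
  growth := by
    obtain ⟨C, K, h⟩ := hc.exists_maassCoeff_le k
    obtain ⟨b, hb⟩ := exists_nat_ge ‖β‖
    refine ⟨b * C + 1, K, fun x hx ↦ ?_⟩
    have hx' : 0 ≤ x.2.1 ∧ 0 ≤ x.1 ∧ x.2.2 ^ 2 ≤ 4 * x.2.1 * x.1 := by
      by_contra h
      exact hx (if_neg h)
    have hn : (0 : ℝ) ≤ x.2.1 := by exact_mod_cast hx'.1
    have hm : (0 : ℝ) ≤ x.1 := by exact_mod_cast hx'.2.1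
    rw [liftCoeff, if_pos hx']
    have h1 : (1 : ℝ) ≤ ((x.2.1 : ℝ) + x.1 + 1) ^ K := one_le_pow₀ (by linarith)
    split_ifs with h0
    · rw [norm_one]
      push_cast
      nlinarith [mul_nonneg (Nat.cast_nonneg b : (0 : ℝ) ≤ b) (Nat.cast_nonneg C : (0 : ℝ) ≤ C)]
    · rw [norm_mul, Complex.norm_intCast]
      have h2 := h _ x.2.2 _ hx'.1 hx'.2.1 hx'.2.2 h0
      have h3 : ((|maassCoeff k c x.2.1 x.2.2 x.1| : ℤ) : ℝ) ≤
        ((C * (x.2.1 + x.1 + 1) ^ K : ℤ) : ℝ) := by exact_mod_cast h2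
      push_cast at h3
      calc ‖β‖ * _ ≤ b * (C * ((x.2.1 : ℝ) + x.1 + 1) ^ K) := by gcongr
        _ ≤ _ := by push_cast; nlinarith

/-- The evaluation `tr(TZ)` of the form `x = (m, n, r)` at `Z`. -/
def formPairing (x : ℤ × ℤ × ℤ) (Z : Matrix (Fin 2) (Fin 2) ℂ) : ℂ :=
  x.1 * Z 1 1 + (x.2.1 * Z 0 0 + x.2.2 * Z 0 1)

/-- The matrices `Z` for which the symmetric matrix with upper triangular part `Im Z` is positive
definite. -/
def siegelDomain : Set (Matrix (Fin 2) (Fin 2) ℂ) :=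
  {Z | 0 < (Z 0 0).im ∧ (Z 0 1).im ^ 2 < (Z 0 0).im * (Z 1 1).im}

/-- The matrices `Z` for which the symmetric matrix with upper triangular part `Im Z - ε` is
positive definite. -/
def thickDomain (ε : ℝ) : Set (Matrix (Fin 2) (Fin 2) ℂ) :=
  {Z | ε < (Z 0 0).im ∧ ε < (Z 1 1).im ∧
    (Z 0 1).im ^ 2 < ((Z 0 0).im - ε) * ((Z 1 1).im - ε)}

lemma exists_mem_thickDomain {Z : Matrix (Fin 2) (Fin 2) ℂ} (hZ : Z ∈ siegelDomain) :
    ∃ ε, 0 < ε ∧ Z ∈ thickDomain ε := by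
  obtain ⟨h0, h1⟩ := hZ
  generalize hy : (Z 0 0).im = y at *
  generalize hy' : (Z 1 1).im = y' at *
  generalize hv : (Z 0 1).im = v at *
  have h2 : 0 < y' := by
    by_contra! h
    nlinarith [sq_nonneg v]
  have hδ : 0 < y * y' - v ^ 2 := by linarith
  have hs : 0 < y + y' := by linarith
  obtain ⟨ε, hε⟩ : ∃ ε, ε = (y * y' - v ^ 2) / (2 * (y + y')) := ⟨_, rfl⟩
  have hε0 : 0 < ε := by rw [hε]; positivity
  have hε2 : 2 * ε * (y + y') = y * y' - v ^ 2 := by rw [hε]; field_simp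
  refine ⟨ε, hε0, ?_, ?_, ?_⟩
  · rw [hy]
    by_contra! h
    nlinarith [sq_nonneg v]
  · rw [hy']
    by_contra! h
    nlinarith [sq_nonneg v]
  · rw [hy, hy', hv]
    nlinarith

lemma le_im_formPairing {ε : ℝ} {Z : Matrix (Fin 2) (Fin 2) ℂ} (hZ : Z ∈ thickDomain ε)
    {x : ℤ × ℤ × ℤ} (hx : 0 ≤ x.2.1 ∧ 0 ≤ x.1 ∧ x.2.2 ^ 2 ≤ 4 * x.2.1 * x.1) :
    ε * (x.2.1 + x.1) ≤ (formPairing x Z).im := by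
  obtain ⟨m, n, r⟩ := x
  obtain ⟨h0, h1, h2⟩ := hZ
  obtain ⟨hn, hm, hr⟩ := hx
  simp only [formPairing, add_im, Complex.mul_im, Complex.intCast_re, Complex.intCast_im, zero_mul,
    add_zero] at hn hm hr ⊢
  generalize (Z 0 0).im = y at *
  generalize (Z 1 1).im = y' at *
  generalize (Z 0 1).im = v at *
  have hn : (0 : ℝ) ≤ n := by exact_mod_cast hn
  have hm : (0 : ℝ) ≤ m := by exact_mod_cast hm
  have hr : (r : ℝ) ^ 2 ≤ 4 * n * m := by exact_mod_cast hr
  have ha : 0 < y - ε := by linarith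
  have hb : 0 < y' - ε := by linarith
  have key : (r * v) ^ 2 ≤ (n * (y - ε) + m * (y' - ε)) ^ 2 := by
    have h3 : (r : ℝ) ^ 2 * v ^ 2 ≤ 4 * n * m * ((y - ε) * (y' - ε)) := by gcongr
    nlinarith [sq_nonneg (n * (y - ε) - m * (y' - ε))]
  have := (abs_le.mp (abs_le_of_sq_le_sq key (by positivity))).1
  nlinarith

lemma summable_exp_neg_mul_abs {δ : ℝ} (hδ : 0 < δ) :
    Summable fun a : ℤ ↦ Real.exp (-(δ * |(a : ℝ)|)) := by
  have h : Summable fun n : ℕ ↦ Real.exp (-(δ * n)) := by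
    have := Real.summable_exp_nat_mul_iff.mpr (neg_lt_zero.mpr hδ)
    refine this.congr fun n ↦ ?_
    ring_nf
  refine Summable.of_nat_of_neg (h.congr fun n ↦ ?_) (h.congr fun n ↦ ?_) <;> simp

lemma IsModerate.exists_bound {a : ℤ × ℤ × ℤ → ℂ} (ha : IsModerate a) {ε : ℝ} (hε : 0 < ε) :
    ∃ u : ℤ × ℤ × ℤ → ℝ, Summable u ∧ ∀ Z ∈ thickDomain ε, ∀ x,
      (1 + 2 * Real.pi * (|(x.1 : ℝ)| + |(x.2.1 : ℝ)| + |(x.2.2 : ℝ)|)) *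
        ‖a x * expTwoPi (formPairing x Z)‖ ≤ u x := by
  obtain ⟨C, K, hC⟩ := ha.growth
  have hπ := Real.pi_pos
  set δ := Real.pi * ε with hδ
  have hδ0 : 0 < δ := by positivity
  have hf := summable_exp_neg_mul_abs (half_pos hδ0)
  set f : ℤ → ℝ := fun a ↦ Real.exp (-(δ / 2 * |(a : ℝ)|))
  have hf0 : 0 ≤ f := fun a ↦ (Real.exp_pos _).le
  set B : ℝ := 16 * C * ((K + 1).factorial / δ ^ (K + 1) * Real.exp δ)
  refine ⟨fun x ↦ B * (f x.1 * (f x.2.1 * f x.2.2)), (hf.mul_of_nonneg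
    (hf.mul_of_nonneg hf hf0 hf0) hf0 fun x ↦ mul_nonneg (hf0 _) (hf0 _)).mul_left _, ?_⟩
  intro Z hZ x
  have hu0 : 0 ≤ B * (f x.1 * (f x.2.1 * f x.2.2)) := by
    have := hf0 x.1
    have := hf0 x.2.1
    have := hf0 x.2.2
    positivity
  by_cases hx : a x = 0
  · simpa [hx] using hu0
  have hs := ha.support x hx
  have hCx := hC x hx
  have him := le_im_formPairing hZ hs
  obtain ⟨hn, hm, hr⟩ := hs
  obtain ⟨m, n, r⟩ := x
  simp only at *
  have hn : (0 : ℝ) ≤ n := by exact_mod_cast hn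
  have hm : (0 : ℝ) ≤ m := by exact_mod_cast hm
  have hr : (r : ℝ) ^ 2 ≤ 4 * n * m := by exact_mod_cast hr
  have hr' : |(r : ℝ)| ≤ n + m :=
    abs_le_of_sq_le_sq (by nlinarith [sq_nonneg ((n : ℝ) - m)]) (by positivity)
  set s : ℝ := n + m with hsdef
  have h1 : 1 + 2 * Real.pi * (|(m : ℝ)| + |(n : ℝ)| + |(r : ℝ)|) ≤ 16 * (s + 1) := by
    rw [abs_of_nonneg hn, abs_of_nonneg hm]
    have h4 := Real.pi_le_four
    have : 2 * Real.pi * (m + n + |(r : ℝ)|) ≤ 2 * 4 * (2 * s) := by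
      gcongr
      linarith
    linarith
  have h2 : ‖a (m, n, r) * expTwoPi (formPairing (m, n, r) Z)‖ ≤
      C * (s + 1) ^ K * Real.exp (-(2 * δ * s)) := by
    rw [norm_mul, norm_expTwoPi]
    have h4 : 2 * δ * s ≤ 2 * Real.pi * (formPairing (m, n, r) Z).im := by
      rw [hδ]
      nlinarith [mul_le_mul_of_nonneg_left him Real.two_pi_pos.le]
    exact mul_le_mul hCx (Real.exp_le_exp.mpr (neg_le_neg h4)) (Real.exp_pos _).le (by positivity)
  have h3 : (s + 1) ^ (K + 1) ≤ (K + 1).factorial / δ ^ (K + 1) * Real.exp (δ * (s + 1)) := by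
    have := Real.pow_div_factorial_le_exp (δ * (s + 1)) (by positivity) (K + 1)
    rw [mul_pow] at this
    rw [div_mul_eq_mul_div, le_div_iff₀ (by positivity)]
    rw [div_le_iff₀ (by positivity)] at this
    linarith
  calc _ ≤ 16 * (s + 1) * (C * (s + 1) ^ K * Real.exp (-(2 * δ * s))) := by gcongr
    _ = 16 * C * (s + 1) ^ (K + 1) * Real.exp (-(2 * δ * s)) := by ring
    _ ≤ 16 * C * ((K + 1).factorial / δ ^ (K + 1) * Real.exp (δ * (s + 1))) *
        Real.exp (-(2 * δ * s)) := by gcongr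
    _ = B * Real.exp (-(δ * s)) := by
      simp only [B, mul_assoc, ← Real.exp_add]
      ring_nf
    _ ≤ B * (f m * (f n * f r)) := by
      simp only [f, ← Real.exp_add]
      gcongr
      rw [abs_of_nonneg hn, abs_of_nonneg hm]
      nlinarith

/-- The Fourier series with the given coefficients. -/
def fourierSeries (a : ℤ × ℤ × ℤ → ℂ) (Z : Matrix (Fin 2) (Fin 2) ℂ) : ℂ :=
  ∑' x, a x * expTwoPi (formPairing x Z)

lemma IsModerate.summable {a : ℤ × ℤ × ℤ → ℂ} (ha : IsModerate a)
    {Z : Matrix (Fin 2) (Fin 2) ℂ} (hZ : Z ∈ siegelDomain) :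
    Summable fun x ↦ a x * expTwoPi (formPairing x Z) := by
  obtain ⟨ε, hε, hZε⟩ := exists_mem_thickDomain hZ
  obtain ⟨u, hu, hbound⟩ := ha.exists_bound hε
  refine .of_norm_bounded hu fun x ↦ le_trans ?_ (hbound Z hZε x)
  exact le_mul_of_one_le_left (norm_nonneg _) (by
    have := Real.pi_pos
    have : 0 ≤ 2 * Real.pi * (|(x.1 : ℝ)| + |(x.2.1 : ℝ)| + |(x.2.2 : ℝ)|) := by positivity
    linarith)

lemma IsModerate.hasSum {a : ℤ × ℤ × ℤ → ℂ} (ha : IsModerate a)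
    {Z : Matrix (Fin 2) (Fin 2) ℂ} (hZ : Z ∈ siegelDomain) :
    HasSum (fun x ↦ a x * expTwoPi (formPairing x Z)) (fourierSeries a Z) :=
  (ha.summable hZ).hasSum

lemma isOpen_thickDomain (ε : ℝ) :
    IsOpen {Z : Fin 2 → Fin 2 → ℂ | Matrix.of Z ∈ thickDomain ε} := by
  simp only [thickDomain, Set.mem_ofPred_eq, Matrix.of_apply]
  refine IsOpen.and ?_ (IsOpen.and ?_ ?_)
  all_goals exact isOpen_lt (by fun_prop) (by fun_prop)

lemma IsModerate.differentiableAt {a : ℤ × ℤ × ℤ → ℂ} (ha : IsModerate a)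
    {Z : Fin 2 → Fin 2 → ℂ} (hZ : Matrix.of Z ∈ siegelDomain) :
    DifferentiableAt ℂ (fun Z : Fin 2 → Fin 2 → ℂ ↦ fourierSeries a (Matrix.of Z)) Z := by
  obtain ⟨ε, hε, hZε⟩ := exists_mem_thickDomain hZ
  obtain ⟨u, hu, hbound⟩ := ha.exists_bound hε
  obtain ⟨δ, hδ, hball⟩ := Metric.isOpen_iff.mp (isOpen_thickDomain ε) Z hZε
  let e (i j : Fin 2) : (Fin 2 → Fin 2 → ℂ) →L[ℂ] ℂ :=
    (ContinuousLinearMap.proj (R := ℂ) (φ := fun _ : Fin 2 ↦ ℂ) j).comp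
      (ContinuousLinearMap.proj (R := ℂ) (φ := fun _ : Fin 2 ↦ Fin 2 → ℂ) i)
  let L (x : ℤ × ℤ × ℤ) : (Fin 2 → Fin 2 → ℂ) →L[ℂ] ℂ :=
    (x.1 : ℂ) • e 1 1 + ((x.2.1 : ℂ) • e 0 0 + (x.2.2 : ℂ) • e 0 1)
  have hL (x W) : formPairing x (Matrix.of W) = L x W := rfl
  have hLnorm (x) : ‖L x‖ ≤ |(x.1 : ℝ)| + |(x.2.1 : ℝ)| + |(x.2.2 : ℝ)| := by
    refine ContinuousLinearMap.opNorm_le_bound _ (by positivity) fun W ↦ ?_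
    have hW (i j : Fin 2) : ‖W i j‖ ≤ ‖W‖ := (norm_le_pi_norm (W i) j).trans (norm_le_pi_norm W i)
    rw [← hL, formPairing]
    simp only [Matrix.of_apply]
    refine (norm_add_le _ _).trans ?_
    have h1 := norm_add_le ((x.2.1 : ℂ) * W 0 0) ((x.2.2 : ℂ) * W 0 1)
    simp only [norm_mul, Complex.norm_intCast] at h1 ⊢
    have h11 := mul_le_mul_of_nonneg_left (hW 1 1) (abs_nonneg (x.1 : ℝ))
    have h00 := mul_le_mul_of_nonneg_left (hW 0 0) (abs_nonneg (x.2.1 : ℝ))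
    have h01 := mul_le_mul_of_nonneg_left (hW 0 1) (abs_nonneg (x.2.2 : ℝ))
    linarith
  refine (hasFDerivAt_tsum_of_isPreconnected hu Metric.isOpen_ball
    (convex_ball Z δ).isPreconnected
    (f' := fun x W ↦ a x • expTwoPi (formPairing x (Matrix.of W)) • ((2 * Real.pi * I : ℂ) • L x))
    (fun x W _ ↦ ?_) (fun x W hW ↦ ?_) (Metric.mem_ball_self hδ) (ha.summable hZ)
    (Metric.mem_ball_self hδ)).differentiableAt
  · exact (((L x).hasFDerivAt.const_mul (2 * Real.pi * I)).cexp).const_mul (a x)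
  · refine le_trans ?_ (hbound (Matrix.of W) (hball hW) x)
    rw [norm_smul, norm_smul, norm_smul, norm_mul (a x)]
    have h1 : ‖(2 * Real.pi * I : ℂ)‖ = 2 * Real.pi := by simp [Real.pi_pos.le]
    rw [h1]
    have h2 := mul_le_mul_of_nonneg_left (hLnorm x) Real.two_pi_pos.le
    have h3 : 0 ≤ ‖a x‖ * ‖expTwoPi (formPairing x (Matrix.of W))‖ := by positivity
    nlinarith

lemma fourierSeries_eq_of_equiv {a : ℤ × ℤ × ℤ → ℂ} (e : ℤ × ℤ × ℤ ≃ ℤ × ℤ × ℤ)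
    {Z Z' : Matrix (Fin 2) (Fin 2) ℂ} (ha : ∀ x, a (e x) = a x)
    (hp : ∀ x, expTwoPi (formPairing (e x) Z) = expTwoPi (formPairing x Z')) :
    fourierSeries a Z' = fourierSeries a Z := by
  rw [fourierSeries, fourierSeries, ← e.tsum_eq fun x ↦ a x * expTwoPi (formPairing x Z)]
  exact tsum_congr fun x ↦ by rw [ha, hp]

lemma fourierSeries_translate (a : ℤ × ℤ × ℤ → ℂ) (Z : Matrix (Fin 2) (Fin 2) ℂ) (s t u : ℤ) :
    fourierSeries a !![Z 0 0 + s, Z 0 1 + t; Z 0 1 + t, Z 1 1 + u] = fourierSeries a Z := by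
  refine fourierSeries_eq_of_equiv (Equiv.refl _) (fun x ↦ rfl) fun x ↦ ?_
  have h : formPairing x !![Z 0 0 + s, Z 0 1 + t; Z 0 1 + t, Z 1 1 + u] =
      formPairing x Z + ((x.1 * u + (x.2.1 * s + x.2.2 * t) : ℤ) : ℂ) := by
    simp [formPairing]
    ring
  rw [h, expTwoPi_add, expTwoPi_int, mul_one, Equiv.refl_apply]

lemma maassCoeff_swap (k : ℕ) (c : ℕ → ℤ) (n r m : ℤ) :
    maassCoeff k c m (-r) n = maassCoeff k c n r m := by
  have h : Int.gcd m (Int.gcd (-r) n) = Int.gcd n (Int.gcd r m) := by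
    rw [Int.neg_gcd, Int.gcd_comm, Int.gcd_comm r n, Int.gcd_assoc]
  rw [maassCoeff, maassCoeff, h]
  refine Finset.sum_congr rfl fun d _ ↦ ?_
  rw [neg_sq, mul_right_comm]

lemma maassCoeff_unipotent (k : ℕ) (c : ℕ → ℤ) (n r m l : ℤ) :
    maassCoeff k c n (r + 2 * l * n) (m + l * r + l ^ 2 * n) = maassCoeff k c n r m := by
  have h : Int.gcd n (Int.gcd (r + 2 * l * n) (m + l * r + l ^ 2 * n)) =
      Int.gcd n (Int.gcd r m) := by
    refine Nat.dvd_antisymm ?_ ?_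
    · set g := Int.gcd n (Int.gcd (r + 2 * l * n) (m + l * r + l ^ 2 * n))
      have hn : (g : ℤ) ∣ n := Int.gcd_dvd_left ..
      have hg : (g : ℤ) ∣ _ := Int.gcd_dvd_right n (Int.gcd (r + 2 * l * n) _)
      have hr : (g : ℤ) ∣ r :=
        (dvd_add_left (hn.mul_left _)).mp (hg.trans (Int.gcd_dvd_left ..))
      have hm : (g : ℤ) ∣ m := (dvd_add_left (hr.mul_left _)).mp <|
        (dvd_add_left (hn.mul_left _)).mp (hg.trans (Int.gcd_dvd_right ..))
      exact Int.dvd_gcd hn (by exact_mod_cast Int.dvd_gcd hr hm)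
    · set g := Int.gcd n (Int.gcd r m)
      have hn : (g : ℤ) ∣ n := Int.gcd_dvd_left ..
      have hg : (g : ℤ) ∣ _ := Int.gcd_dvd_right n (Int.gcd r m)
      have hr : (g : ℤ) ∣ r := hg.trans (Int.gcd_dvd_left ..)
      have hm : (g : ℤ) ∣ m := hg.trans (Int.gcd_dvd_right ..)
      have h1 : (g : ℤ) ∣ r + 2 * l * n := dvd_add hr (hn.mul_left _)
      have h2 : (g : ℤ) ∣ m + l * r + l ^ 2 * n :=
        dvd_add (dvd_add hm (hr.mul_left _)) (hn.mul_left _)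
      exact Int.dvd_gcd hn (by exact_mod_cast Int.dvd_gcd h1 h2)
  rw [maassCoeff, maassCoeff, h]
  refine Finset.sum_congr rfl fun d _ ↦ ?_
  congr 3
  ring

lemma liftCoeff_swap (β : ℂ) (k : ℕ) (c : ℕ → ℤ) (m n r : ℤ) :
    liftCoeff β k c (n, m, -r) = liftCoeff β k c (m, n, r) := by
  have h1 : (0 ≤ m ∧ 0 ≤ n ∧ (-r) ^ 2 ≤ 4 * m * n) ↔ (0 ≤ n ∧ 0 ≤ m ∧ r ^ 2 ≤ 4 * n * m) := by
    rw [neg_sq, mul_right_comm]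
    tauto
  simp only [liftCoeff, h1, maassCoeff_swap, and_comm (a := m = 0)]

lemma semidefinite_unipotent {n r m : ℤ} (l : ℤ) (h : 0 ≤ n ∧ 0 ≤ m ∧ r ^ 2 ≤ 4 * n * m) :
    0 ≤ n ∧ 0 ≤ m + l * r + l ^ 2 * n ∧
      (r + 2 * l * n) ^ 2 ≤ 4 * n * (m + l * r + l ^ 2 * n) := by
  obtain ⟨hn, hm, hr⟩ := h
  refine ⟨hn, ?_, by linarith [sq_nonneg r]⟩
  rcases hn.eq_or_lt with rfl | hn
  · have : r = 0 := by nlinarith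
    simpa [this] using hm
  · by_contra! h
    nlinarith [sq_nonneg (r + 2 * l * n)]

lemma liftCoeff_unipotent (β : ℂ) (k : ℕ) (c : ℕ → ℤ) (m n r l : ℤ) :
    liftCoeff β k c (m + l * r + l ^ 2 * n, n, r + 2 * l * n) = liftCoeff β k c (m, n, r) := by
  have h1 : (0 ≤ n ∧ 0 ≤ m + l * r + l ^ 2 * n ∧
      (r + 2 * l * n) ^ 2 ≤ 4 * n * (m + l * r + l ^ 2 * n)) ↔
      (0 ≤ n ∧ 0 ≤ m ∧ r ^ 2 ≤ 4 * n * m) := by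
    refine ⟨fun h ↦ ?_, semidefinite_unipotent l⟩
    convert semidefinite_unipotent (-l) h using 2 <;> ring_nf
  simp only [liftCoeff, h1, maassCoeff_unipotent]
  refine if_ctx_congr Iff.rfl (fun h ↦ if_congr ?_ rfl rfl) fun _ ↦ rfl
  refine and_congr_right fun hn ↦ ?_
  have : r = 0 := by subst hn; nlinarith [h.2.2]
  simp [hn, this]

lemma fourierSeries_swap (β : ℂ) (k : ℕ) (c : ℕ → ℤ) (Z : Matrix (Fin 2) (Fin 2) ℂ) :
    fourierSeries (liftCoeff β k c) !![Z 1 1, -Z 0 1; -Z 0 1, Z 0 0] =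
      fourierSeries (liftCoeff β k c) Z := by
  refine fourierSeries_eq_of_equiv
    ⟨fun x ↦ (x.2.1, x.1, -x.2.2), fun x ↦ (x.2.1, x.1, -x.2.2), fun x ↦ by simp,
      fun x ↦ by simp⟩ (fun x ↦ liftCoeff_swap ..) fun x ↦ congrArg _ ?_
  simp [formPairing]
  ring

lemma fourierSeries_unipotent (β : ℂ) (k : ℕ) (c : ℕ → ℤ) (Z : Matrix (Fin 2) (Fin 2) ℂ) (l : ℤ) :
    fourierSeries (liftCoeff β k c) !![Z 0 0 + 2 * l * Z 0 1 + l ^ 2 * Z 1 1, Z 0 1 + l * Z 1 1;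
      Z 0 1 + l * Z 1 1, Z 1 1] = fourierSeries (liftCoeff β k c) Z := by
  refine (fourierSeries_eq_of_equiv
    ⟨fun x ↦ (x.1 + l * x.2.2 + l ^ 2 * x.2.1, x.2.1, x.2.2 + 2 * l * x.2.1),
      fun x ↦ (x.1 + (-l) * x.2.2 + (-l) ^ 2 * x.2.1, x.2.1, x.2.2 + 2 * (-l) * x.2.1),
      fun x ↦ by ext <;> (simp; try ring), fun x ↦ by ext <;> (simp; try ring)⟩
    (fun x ↦ liftCoeff_unipotent ..) fun x ↦ congrArg _ ?_)
  simp [formPairing]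
  ring

lemma siegelDomain_neg_inv {Z : Matrix (Fin 2) (Fin 2) ℂ} (hZ : Z ∈ siegelDomain) :
    !![-1 / Z 0 0, Z 0 1 / Z 0 0; Z 0 1 / Z 0 0, Z 1 1 - Z 0 1 ^ 2 / Z 0 0] ∈ siegelDomain := by
  obtain ⟨h0, h1⟩ := hZ
  have hne : Z 0 0 ≠ 0 := fun h ↦ by simp [h] at h0
  have hN : 0 < normSq (Z 0 0) := normSq_pos.mpr hne
  have hN' : normSq (Z 0 0) = (Z 0 0).re * (Z 0 0).re + (Z 0 0).im * (Z 0 0).im := normSq_apply _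
  have e1 : (-1 / Z 0 0).im = (Z 0 0).im / normSq (Z 0 0) := by
    simp [neg_div]
  have e2 : (Z 0 1 / Z 0 0).im =
      ((Z 0 1).im * (Z 0 0).re - (Z 0 1).re * (Z 0 0).im) / normSq (Z 0 0) := by
    rw [Complex.div_im]
    ring
  have e3 : (Z 1 1 - Z 0 1 ^ 2 / Z 0 0).im = (Z 1 1).im - (2 * (Z 0 1).re * (Z 0 1).im *
      (Z 0 0).re - ((Z 0 1).re ^ 2 - (Z 0 1).im ^ 2) * (Z 0 0).im) / normSq (Z 0 0) := by
    rw [sub_im, Complex.div_im, pow_two, Complex.mul_im, Complex.mul_re]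
    ring
  refine ⟨?_, ?_⟩
  · simp only [Matrix.of_apply, cons_val', cons_val_zero]
    rw [e1]
    positivity
  · simp only [Matrix.of_apply, cons_val', cons_val_zero, cons_val_one, cons_val_fin_one]
    rw [e1, e2, e3]
    generalize normSq (Z 0 0) = N at *
    generalize (Z 0 0).im = y at *
    generalize (Z 0 0).re = x at *
    generalize (Z 0 1).im = v at *
    generalize (Z 0 1).re = u at *
    generalize (Z 1 1).im = w at *
    have key : y / N * (w - (2 * u * v * x - (u ^ 2 - v ^ 2) * y) / N) - ((v * x - u * y) / N) ^ 2 =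
        (y * w - v ^ 2) / N := by
      field_simp
      rw [hN']
      ring
    have : 0 < (y * w - v ^ 2) / N := div_pos (by linarith) hN
    linarith

lemma IsJacobiForm.fourierSeries_neg_inv {k : ℕ} {c : ℕ → ℤ} {φ : ℂ → ℂ → ℂ}
    (h : IsJacobiForm k c φ) (hc : c 0 = 1) (hk : 4 ≤ k) (hk2 : Even k)
    {Z : Matrix (Fin 2) (Fin 2) ℂ} (hZ : Z ∈ siegelDomain) :
    fourierSeries (liftCoeff (-(2 * k / bernoulli k : ℂ)) k c)
      !![-1 / Z 0 0, Z 0 1 / Z 0 0; Z 0 1 / Z 0 0, Z 1 1 - Z 0 1 ^ 2 / Z 0 0] =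
      Z 0 0 ^ k * fourierSeries (liftCoeff (-(2 * k / bernoulli k : ℂ)) k c) Z := by
  obtain ⟨g, hg⟩ := exists_fourierJacobi h hc hk hk2
  have hmod := isModerate_liftCoeff h.growth (-(2 * k / bernoulli k : ℂ)) k
  have key {W : Matrix (Fin 2) (Fin 2) ℂ} (hW : W ∈ siegelDomain) :
      HasSum (fun m : ℤ ↦ expTwoPi (m * W 1 1) * g m (W 0 0) (W 0 1))
        (fourierSeries (liftCoeff (-(2 * k / bernoulli k : ℂ)) k c) W) := by
    refine (hmod.hasSum hW).prod_fiberwise fun m ↦ ?_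
    refine ((hg m (W 0 0) (W 0 1) hW.1).1.mul_left (expTwoPi (m * W 1 1))).congr_fun fun x ↦ ?_
    rw [formPairing, expTwoPi_add]
    ring
  refine (key (siegelDomain_neg_inv hZ)).unique (((key hZ).mul_left _).congr_fun fun m ↦ ?_)
  simp only [Matrix.of_apply, cons_val', cons_val_zero, cons_val_one, cons_val_fin_one]
  rw [(hg m (Z 0 0) (Z 0 1) hZ.1).2]
  have : expTwoPi (m * Z 1 1) = expTwoPi (m * (Z 1 1 - Z 0 1 ^ 2 / Z 0 0)) *
      expTwoPi (m * (Z 0 1 ^ 2 / Z 0 0)) := by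
    rw [← expTwoPi_add]
    ring_nf
  rw [this]
  ring

/-- The symmetric matrices with positive definite imaginary part. -/
def siegelPlane : Set (Matrix (Fin 2) (Fin 2) ℂ) := {Z | Z 1 0 = Z 0 1 ∧ Z ∈ siegelDomain}

/-- `F` transforms with weight `k` under the fractional linear transformation given by `M`. -/
def TransformsUnder (F : Matrix (Fin 2) (Fin 2) ℂ → ℂ) (k : ℕ)
    (M : Matrix (Fin 2 ⊕ Fin 2) (Fin 2 ⊕ Fin 2) ℤ) : Prop :=
  ∀ Z ∈ siegelPlane, ∃ Z' ∈ siegelPlane, ∃ J : Matrix (Fin 2) (Fin 2) ℂ, J.det ≠ 0 ∧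
    M.map (Int.castRingHom ℂ) * fromBlocks Z 0 1 0 =
      fromBlocks Z' 0 1 0 * fromBlocks J 0 0 0 ∧ F Z' = J.det ^ k * F Z

lemma TransformsUnder.mul {F : Matrix (Fin 2) (Fin 2) ℂ → ℂ} {k : ℕ}
    {M N : Matrix (Fin 2 ⊕ Fin 2) (Fin 2 ⊕ Fin 2) ℤ} (hM : TransformsUnder F k M)
    (hN : TransformsUnder F k N) : TransformsUnder F k (M * N) := by
  intro Z hZ
  obtain ⟨Z₁, hZ₁, J₁, hJ₁, h₁, hF₁⟩ := hN Z hZ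
  obtain ⟨Z₂, hZ₂, J₂, hJ₂, h₂, hF₂⟩ := hM Z₁ hZ₁
  refine ⟨Z₂, hZ₂, J₂ * J₁, by simp [hJ₁, hJ₂], ?_, ?_⟩
  · rw [Matrix.map_mul, Matrix.mul_assoc, h₁, ← Matrix.mul_assoc, h₂, Matrix.mul_assoc,
      fromBlocks_multiply J₂]
    simp
  · rw [hF₂, hF₁, det_mul, mul_pow, mul_assoc]

lemma transformsUnder_one (F : Matrix (Fin 2) (Fin 2) ℂ → ℂ) (k : ℕ) : TransformsUnder F k 1 :=
  fun Z hZ ↦ ⟨Z, hZ, 1, by simp, by simp [fromBlocks_multiply], by simp⟩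

lemma transformsUnder_neg_one (F : Matrix (Fin 2) (Fin 2) ℂ → ℂ) (k : ℕ) :
    TransformsUnder F k (-1) := by
  refine fun Z hZ ↦ ⟨Z, hZ, -1, by simp [det_fin_two], ?_, by simp [det_fin_two]⟩
  rw [Matrix.map_neg _ (map_neg _), Matrix.map_one _ (map_zero _) (map_one _)]
  simp [fromBlocks_multiply, fromBlocks_neg]

lemma TransformsUnder.of_mul_eq_one {F : Matrix (Fin 2) (Fin 2) ℂ → ℂ} {k : ℕ}
    {M P Q : Matrix (Fin 2 ⊕ Fin 2) (Fin 2 ⊕ Fin 2) ℤ} (hPQ : Q * P = 1)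
    (hQ : TransformsUnder F k Q) (hM : TransformsUnder F k (P * M)) : TransformsUnder F k M := by
  simpa [← Matrix.mul_assoc, hPQ] using hQ.mul hM

lemma transformsUnder_fromBlocks {F : Matrix (Fin 2) (Fin 2) ℂ → ℂ} {k : ℕ}
    {A B C D : Matrix (Fin 2) (Fin 2) ℤ}
    (h : ∀ Z ∈ siegelPlane, ∃ Z' ∈ siegelPlane, ∃ J : Matrix (Fin 2) (Fin 2) ℂ, J.det ≠ 0 ∧
      A.map (Int.castRingHom ℂ) * Z + B.map (Int.castRingHom ℂ) = Z' * J ∧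
      C.map (Int.castRingHom ℂ) * Z + D.map (Int.castRingHom ℂ) = J ∧
      F Z' = J.det ^ k * F Z) : TransformsUnder F k (fromBlocks A B C D) := by
  intro Z hZ
  obtain ⟨Z', hZ', J, hJ, h1, h2, h3⟩ := h Z hZ
  refine ⟨Z', hZ', J, hJ, ?_, h3⟩
  rw [fromBlocks_map, fromBlocks_multiply, fromBlocks_multiply]
  simp only [Matrix.mul_one, Matrix.mul_zero, Matrix.one_mul, add_zero, h1, h2]

lemma mul_eq_one_of_hom {ρ : SpecialLinearGroup (Fin 2) ℤ →*
    Matrix (Fin 2 ⊕ Fin 2) (Fin 2 ⊕ Fin 2) ℤ} (g : SpecialLinearGroup (Fin 2) ℤ) :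
    ρ g⁻¹ * ρ g = 1 := by
  rw [← map_mul, inv_mul_cancel, map_one]

lemma transformsUnder_hom {F : Matrix (Fin 2) (Fin 2) ℂ → ℂ} {k : ℕ}
    (ρ : SpecialLinearGroup (Fin 2) ℤ →* Matrix (Fin 2 ⊕ Fin 2) (Fin 2 ⊕ Fin 2) ℤ)
    (hS : TransformsUnder F k (ρ ModularGroup.S)) (hT : TransformsUnder F k (ρ ModularGroup.T))
    (hT' : TransformsUnder F k (ρ ModularGroup.T⁻¹)) (g : SpecialLinearGroup (Fin 2) ℤ) :
    TransformsUnder F k (ρ g) := by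
  suffices h : TransformsUnder F k (ρ g) ∧ TransformsUnder F k (ρ g⁻¹) from h.1
  have hg : g ∈ Subgroup.closure {ModularGroup.S, ModularGroup.T} := by
    rw [SpecialLinearGroup.SL2Z_generators]
    trivial
  induction hg using Subgroup.closure_induction with
  | mem x hx =>
    rcases hx with rfl | rfl
    · refine ⟨hS, ?_⟩
      have : ModularGroup.S⁻¹ = ModularGroup.S * ModularGroup.S * ModularGroup.S := by decide
      rw [this, map_mul, map_mul]
      exact (hS.mul hS).mul hS
    · exact ⟨hT, hT'⟩
  | one => simpa using transformsUnder_one F k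
  | mul x y _ _ hx hy =>
    rw [_root_.mul_inv_rev, map_mul, map_mul]
    exact ⟨hx.1.mul hy.1, hy.2.mul hx.2⟩
  | inv x _ hx => exact ⟨hx.2, by simpa using hx.1⟩

/-- Invariance under generators of the Siegel modular group. -/
structure IsSiegelInvariant (F : Matrix (Fin 2) (Fin 2) ℂ → ℂ) (k : ℕ) : Prop where
  translate : ∀ Z : Matrix (Fin 2) (Fin 2) ℂ, ∀ s t u : ℤ,
    F !![Z 0 0 + s, Z 0 1 + t; Z 0 1 + t, Z 1 1 + u] = F Z
  swap : ∀ Z, F !![Z 1 1, -Z 0 1; -Z 0 1, Z 0 0] = F Z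
  unipotent : ∀ Z : Matrix (Fin 2) (Fin 2) ℂ, ∀ l : ℤ,
    F !![Z 0 0 + 2 * l * Z 0 1 + l ^ 2 * Z 1 1, Z 0 1 + l * Z 1 1;
      Z 0 1 + l * Z 1 1, Z 1 1] = F Z
  neg_inv : ∀ Z ∈ siegelDomain, F !![-1 / Z 0 0, Z 0 1 / Z 0 0;
      Z 0 1 / Z 0 0, Z 1 1 - Z 0 1 ^ 2 / Z 0 0] = Z 0 0 ^ k * F Z

/-- The embedding `U ↦ diag(U, U⁻ᵀ)` of `SL₂(ℤ)`. -/
def leviHom : SpecialLinearGroup (Fin 2) ℤ →* Matrix (Fin 2 ⊕ Fin 2) (Fin 2 ⊕ Fin 2) ℤ where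
  toFun g := fromBlocks !![g 0 0, g 0 1; g 1 0, g 1 1] 0 0 !![g 1 1, -g 1 0; -g 0 1, g 0 0]
  map_one' := by
    rw [← fromBlocks_one]
    congr <;> ext i j <;> fin_cases i <;> fin_cases j <;> simp
  map_mul' g h := by
    rw [fromBlocks_multiply]
    congr <;> ext i j <;> fin_cases i <;> fin_cases j <;>
      simp [Matrix.mul_apply, Fin.sum_univ_two] <;> ring

/-- The embedding of `SL₂(ℤ)` acting on the first coordinates. -/
def fstHom : SpecialLinearGroup (Fin 2) ℤ →* Matrix (Fin 2 ⊕ Fin 2) (Fin 2 ⊕ Fin 2) ℤ where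
  toFun g := fromBlocks !![g 0 0, 0; 0, 1] !![g 0 1, 0; 0, 0] !![g 1 0, 0; 0, 0] !![g 1 1, 0; 0, 1]
  map_one' := by
    rw [← fromBlocks_one]
    congr <;> ext i j <;> fin_cases i <;> fin_cases j <;> simp
  map_mul' g h := by
    rw [fromBlocks_multiply]
    congr <;> ext i j <;> fin_cases i <;> fin_cases j <;>
      simp [Matrix.mul_apply, Fin.sum_univ_two]

/-- The embedding of `SL₂(ℤ)` acting on the second coordinates. -/
def sndHom : SpecialLinearGroup (Fin 2) ℤ →* Matrix (Fin 2 ⊕ Fin 2) (Fin 2 ⊕ Fin 2) ℤ where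
  toFun g := fromBlocks !![1, 0; 0, g 0 0] !![0, 0; 0, g 0 1] !![0, 0; 0, g 1 0] !![1, 0; 0, g 1 1]
  map_one' := by
    rw [← fromBlocks_one]
    congr <;> ext i j <;> fin_cases i <;> fin_cases j <;> simp
  map_mul' g h := by
    rw [fromBlocks_multiply]
    congr <;> ext i j <;> fin_cases i <;> fin_cases j <;>
      simp [Matrix.mul_apply, Fin.sum_univ_two]

lemma sndHom_eq (g : SpecialLinearGroup (Fin 2) ℤ) :
    sndHom g = leviHom ModularGroup.S * fstHom g * leviHom ModularGroup.S⁻¹ := by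
  have hS : leviHom ModularGroup.S = fromBlocks !![0, -1; 1, 0] 0 0 !![0, -1; 1, 0] := by decide
  have hS' : leviHom ModularGroup.S⁻¹ = fromBlocks !![0, 1; -1, 0] 0 0 !![0, 1; -1, 0] := by decide
  simp only [hS, hS', sndHom, fstHom, MonoidHom.coe_mk, OneHom.coe_mk, fromBlocks_multiply]
  congr <;> ext i j <;> fin_cases i <;> fin_cases j <;>
    simp

namespace IsSiegelInvariant

variable {F : Matrix (Fin 2) (Fin 2) ℂ → ℂ} {k : ℕ}

lemma transformsUnder_translate (hF : IsSiegelInvariant F k) (s t u : ℤ) :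
    TransformsUnder F k (fromBlocks 1 !![s, t; t, u] 0 1) := by
  refine transformsUnder_fromBlocks fun Z hZ ↦
    ⟨!![Z 0 0 + s, Z 0 1 + t; Z 0 1 + t, Z 1 1 + u], ⟨rfl, ?_⟩, 1, by simp, ?_, ?_, ?_⟩
  · simpa [siegelDomain] using hZ.2
  · ext i j
    fin_cases i <;> fin_cases j <;> simp [hZ.1]
  · simp
  · simpa using hF.translate Z s t u

lemma transformsUnder_unipotent (hF : IsSiegelInvariant F k) (l : ℤ) :
    TransformsUnder F k (fromBlocks !![1, l; 0, 1] 0 0 !![1, 0; -l, 1]) := by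
  refine transformsUnder_fromBlocks fun Z hZ ↦
    ⟨!![Z 0 0 + 2 * l * Z 0 1 + l ^ 2 * Z 1 1, Z 0 1 + l * Z 1 1; Z 0 1 + l * Z 1 1, Z 1 1],
      ⟨rfl, ?_⟩, !![1, 0; -l, 1], by simp [det_fin_two], ?_, ?_, ?_⟩
  · obtain ⟨-, h0, h1⟩ := hZ
    have e : (Z 0 0 + 2 * l * Z 0 1 + l ^ 2 * Z 1 1).im =
        (Z 0 0).im + 2 * l * (Z 0 1).im + l ^ 2 * (Z 1 1).im := by
      have h2 : ((l : ℂ) ^ 2 * Z 1 1).im = l ^ 2 * (Z 1 1).im := by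
        rw [← ofReal_intCast, ← ofReal_pow, im_ofReal_mul]
      simp [h2]
    simp only [siegelDomain, Set.mem_ofPred_eq, of_apply, cons_val', cons_val_zero, cons_val_one,
      cons_val_fin_one]
    have e' : (Z 0 1 + l * Z 1 1).im = (Z 0 1).im + l * (Z 1 1).im := by simp
    rw [e, e']
    generalize (Z 0 0).im = y at *
    generalize (Z 0 1).im = v at *
    generalize (Z 1 1).im = w at *
    refine ⟨?_, by nlinarith⟩
    by_contra! h
    have hw : 0 < w := by
      by_contra! h
      nlinarith [sq_nonneg v]
    nlinarith [sq_nonneg (v + l * w)]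
  · ext i j
    fin_cases i <;> fin_cases j <;> simp [Matrix.mul_apply, Fin.sum_univ_two, hZ.1] <;> ring
  · ext i j
    fin_cases i <;> fin_cases j <;> simp
  · simpa [det_fin_two] using hF.unipotent Z l

lemma transformsUnder_leviHom (hF : IsSiegelInvariant F k) (g : SpecialLinearGroup (Fin 2) ℤ) :
    TransformsUnder F k (leviHom g) := by
  refine transformsUnder_hom _ ?_ ?_ ?_ g
  · refine transformsUnder_fromBlocks fun Z hZ ↦
      ⟨!![Z 1 1, -Z 0 1; -Z 0 1, Z 0 0], ⟨rfl, ?_⟩, !![0, -1; 1, 0], by simp [det_fin_two], ?_, ?_, ?_⟩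
    · obtain ⟨-, h0, h1⟩ := hZ
      refine ⟨?_, by simpa [mul_comm] using h1⟩
      simp only [of_apply, cons_val', cons_val_zero, cons_val_fin_one]
      by_contra! h
      nlinarith [sq_nonneg (Z 0 1).im]
    · ext i j
      fin_cases i <;> fin_cases j <;> simp [Matrix.mul_apply, Fin.sum_univ_two, hZ.1, ModularGroup.S]
    · ext i j
      fin_cases i <;> fin_cases j <;> simp [ModularGroup.S]
    · simpa [det_fin_two] using hF.swap Z
  · convert hF.transformsUnder_unipotent 1
    decide
  · convert hF.transformsUnder_unipotent (-1)
    decide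

lemma transformsUnder_fstHom (hF : IsSiegelInvariant F k) (g : SpecialLinearGroup (Fin 2) ℤ) :
    TransformsUnder F k (fstHom g) := by
  refine transformsUnder_hom _ ?_ ?_ ?_ g
  · refine transformsUnder_fromBlocks fun Z hZ ↦ ?_
    have hne : Z 0 0 ≠ 0 := fun h ↦ by simpa [h] using hZ.2.1
    refine ⟨_, ⟨rfl, siegelDomain_neg_inv hZ.2⟩, !![Z 0 0, Z 0 1; 0, 1],
      by simpa [det_fin_two], ?_, ?_, ?_⟩
    · ext i j
      fin_cases i <;> fin_cases j <;>
        simp [Matrix.mul_apply, Fin.sum_univ_two, hZ.1, ModularGroup.S] <;> field_simp <;> ring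
    · ext i j
      fin_cases i <;> fin_cases j <;> simp [Matrix.mul_apply, Fin.sum_univ_two, ModularGroup.S]
    · simpa [det_fin_two] using hF.neg_inv Z hZ.2
  · convert hF.transformsUnder_translate 1 0 0
    decide
  · convert hF.transformsUnder_translate (-1) 0 0
    decide

lemma transformsUnder_sndHom (hF : IsSiegelInvariant F k) (g : SpecialLinearGroup (Fin 2) ℤ) :
    TransformsUnder F k (sndHom g) := by
  rw [sndHom_eq]
  exact ((hF.transformsUnder_leviHom _).mul (hF.transformsUnder_fstHom _)).mul
    (hF.transformsUnder_leviHom _)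

end IsSiegelInvariant

lemma siegelModularGroup_apply {M : Matrix (Fin 2 ⊕ Fin 2) (Fin 2 ⊕ Fin 2) ℤ}
    (hM : M ∈ SiegelModularGroup 2) (i j : Fin 2 ⊕ Fin 2) :
    M (.inr 0) i * M (.inl 0) j + M (.inr 1) i * M (.inl 1) j - M (.inl 0) i * M (.inr 0) j -
      M (.inl 1) i * M (.inr 1) j = Jn 2 i j := by
  have h := congrFun (congrFun (hM : Mᵀ * Jn 2 * M = Jn 2) i) j
  rw [← h]
  simp [Matrix.mul_apply, Fintype.sum_sum_type, Jn, Fin.sum_univ_two]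
  ring

lemma mul_mem_siegelModularGroup {n : ℕ} {M N : Matrix (Fin n ⊕ Fin n) (Fin n ⊕ Fin n) ℤ}
    (hM : M ∈ SiegelModularGroup n) (hN : N ∈ SiegelModularGroup n) :
    M * N ∈ SiegelModularGroup n := by
  have hM : Mᵀ * Jn n * M = Jn n := hM
  have hN : Nᵀ * Jn n * N = Jn n := hN
  change (M * N)ᵀ * Jn n * (M * N) = Jn n
  calc (M * N)ᵀ * Jn n * (M * N) = Nᵀ * (Mᵀ * Jn n * M) * N := by
        simp only [transpose_mul, Matrix.mul_assoc]
    _ = Jn n := by rw [hM, hN]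

lemma fromBlocks_mem_siegelModularGroup {n : ℕ} {A B C D : Matrix (Fin n) (Fin n) ℤ}
    (hAC : Cᵀ * A = Aᵀ * C) (hBD : Dᵀ * B = Bᵀ * D) (hAD : Aᵀ * D = 1 + Cᵀ * B) :
    fromBlocks A B C D ∈ SiegelModularGroup n := by
  have hDA : Dᵀ * A = 1 + Bᵀ * C := by simpa using congrArg transpose hAD
  change (fromBlocks A B C D)ᵀ * Jn n * fromBlocks A B C D = Jn n
  rw [fromBlocks_transpose, Jn, fromBlocks_multiply, fromBlocks_multiply]
  simp [hAC, hBD, hAD, hDA]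

lemma det_eq_one (g : Matrix.SpecialLinearGroup (Fin 2) ℤ) :
    g 0 0 * g 1 1 - g 0 1 * g 1 0 = 1 := by
  rw [← det_fin_two]
  exact g.det_coe

lemma leviHom_mem (g : Matrix.SpecialLinearGroup (Fin 2) ℤ) : leviHom g ∈ SiegelModularGroup 2 := by
  have h := det_eq_one g
  refine fromBlocks_mem_siegelModularGroup (by simp) (by simp) ?_
  ext i j
  fin_cases i <;> fin_cases j <;> simp [Matrix.mul_apply, Fin.sum_univ_two] <;> linarith

lemma fstHom_mem (g : Matrix.SpecialLinearGroup (Fin 2) ℤ) : fstHom g ∈ SiegelModularGroup 2 := by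
  have h := det_eq_one g
  refine fromBlocks_mem_siegelModularGroup ?_ ?_ ?_ <;> ext i j <;>
    fin_cases i <;> fin_cases j <;> simp [Matrix.mul_apply, Fin.sum_univ_two] <;> linarith

lemma sndHom_mem (g : Matrix.SpecialLinearGroup (Fin 2) ℤ) : sndHom g ∈ SiegelModularGroup 2 := by
  have h := det_eq_one g
  refine fromBlocks_mem_siegelModularGroup ?_ ?_ ?_ <;> ext i j <;>
    fin_cases i <;> fin_cases j <;> simp [Matrix.mul_apply, Fin.sum_univ_two] <;> linarith

lemma exists_specialLinearGroup_row (a c : ℤ) :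
    ∃ g : Matrix.SpecialLinearGroup (Fin 2) ℤ, g 1 0 * a + g 1 1 * c = 0 := by
  by_cases h : a = 0 ∧ c = 0
  · exact ⟨1, by simp [h]⟩
  have hg : 0 < Int.gcd a c := by
    rw [Int.gcd_pos_iff]
    tauto
  obtain ⟨a', c', hco, ha, hc⟩ := Int.exists_gcd_one hg
  have hco : IsCoprime (-c') a' :=
    (Int.isCoprime_iff_gcd_eq_one.mpr hco).symm.neg_left
  obtain ⟨g, hg0, hg1⟩ := hco.exists_SL2_row 1
  refine ⟨g, ?_⟩
  rw [hg0, hg1]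
  linear_combination (-c') * ha + a' * hc

namespace IsSiegelInvariant

variable {F : Matrix (Fin 2) (Fin 2) ℂ → ℂ} {k : ℕ} {M : Matrix (Fin 2 ⊕ Fin 2) (Fin 2 ⊕ Fin 2) ℤ}

lemma transformsUnder_of_parabolic (hF : IsSiegelInvariant F k) (hM : M ∈ SiegelModularGroup 2)
    (h0 : M (.inl 0) (.inl 0) = 1) (h1 : M (.inl 1) (.inl 0) = 0) (h2 : M (.inr 0) (.inl 0) = 0)
    (h3 : M (.inr 1) (.inl 0) = 0) (h4 : M (.inl 1) (.inl 1) = 1) (h5 : M (.inl 1) (.inr 1) = 0)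
    (h6 : M (.inr 1) (.inl 1) = 0) (h7 : M (.inr 1) (.inr 1) = 1) : TransformsUnder F k M := by
  have e (i j) := siegelModularGroup_apply hM i j
  have r1 := e (.inl 0) (.inl 1)
  have r2 := e (.inl 0) (.inr 0)
  have r3 := e (.inl 0) (.inr 1)
  have r4 := e (.inl 1) (.inr 0)
  have r5 := e (.inr 0) (.inr 1)
  simp [h0, h1, h2, h3, h4, h5, h6, h7, Jn] at r1 r2 r3 r4 r5
  simp [r1, r2, r3] at r4 r5
  have : M = fromBlocks 1 !![M (.inl 0) (.inr 0) + M (.inl 0) (.inl 1) * M (.inl 0) (.inr 1),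
      M (.inl 0) (.inr 1); M (.inl 0) (.inr 1), 0] 0 1 *
      fromBlocks !![1, M (.inl 0) (.inl 1); 0, 1] 0 0 !![1, 0; -M (.inl 0) (.inl 1), 1] := by
    rw [fromBlocks_multiply]
    ext i j
    rcases i with i | i <;> rcases j with j | j <;> fin_cases i <;> fin_cases j <;>
      simp [h0, h1, h2, h3, h4, h5, h6, h7, r1, r2, r3] <;> linarith
  rw [this]
  exact (hF.transformsUnder_translate _ _ _).mul (hF.transformsUnder_unipotent _)

lemma transformsUnder_of_fst_column (hF : IsSiegelInvariant F k) (hM : M ∈ SiegelModularGroup 2)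
    (h0 : M (.inl 0) (.inl 0) = 1) (h1 : M (.inl 1) (.inl 0) = 0) (h2 : M (.inr 0) (.inl 0) = 0)
    (h3 : M (.inr 1) (.inl 0) = 0) : TransformsUnder F k M := by
  have r1 := siegelModularGroup_apply hM (.inl 0) (.inl 1)
  have r2 := siegelModularGroup_apply hM (.inl 0) (.inr 1)
  have r3 := siegelModularGroup_apply hM (.inl 1) (.inr 1)
  simp [h0, h1, h2, h3, Jn] at r1 r2 r3
  simp [r1, r2] at r3
  let g : Matrix.SpecialLinearGroup (Fin 2) ℤ :=
    ⟨!![M (.inr 1) (.inr 1), -M (.inl 1) (.inr 1); -M (.inr 1) (.inl 1), M (.inl 1) (.inl 1)],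
      by rw [det_fin_two_of]; linarith⟩
  refine .of_mul_eq_one (mul_eq_one_of_hom g) (hF.transformsUnder_sndHom _) ?_
  apply hF.transformsUnder_of_parabolic (mul_mem_siegelModularGroup (sndHom_mem g) hM) <;>
    simp [Matrix.mul_apply, Fintype.sum_sum_type, Fin.sum_univ_two, sndHom, g, h0, h1, h2, h3] <;>
    linarith

lemma transformsUnder_of_fst_column_eq_smul (hF : IsSiegelInvariant F k)
    (hM : M ∈ SiegelModularGroup 2) (h1 : M (.inl 1) (.inl 0) = 0) (h2 : M (.inr 0) (.inl 0) = 0)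
    (h3 : M (.inr 1) (.inl 0) = 0) : TransformsUnder F k M := by
  have r := siegelModularGroup_apply hM (.inl 0) (.inr 0)
  simp [h1, h2, h3, Jn] at r
  rcases Int.isUnit_iff.mp (IsUnit.of_mul_eq_one _ r) with h0 | h0
  · exact hF.transformsUnder_of_fst_column hM h0 h1 h2 h3
  · refine .of_mul_eq_one (P := -1) (Q := -1) (by simp) (transformsUnder_neg_one F k) ?_
    refine hF.transformsUnder_of_fst_column ?_ ?_ ?_ ?_ ?_
    · have hM : Mᵀ * Jn 2 * M = Jn 2 := hM
      change (-1 * M)ᵀ * Jn 2 * (-1 * M) = Jn 2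
      simpa using hM
    all_goals simp [h0, h1, h2, h3]

lemma transformsUnder (hF : IsSiegelInvariant F k) (hM : M ∈ SiegelModularGroup 2) :
    TransformsUnder F k M := by
  obtain ⟨g, hg⟩ := exists_specialLinearGroup_row (M (.inl 0) (.inl 0)) (M (.inr 0) (.inl 0))
  refine .of_mul_eq_one (mul_eq_one_of_hom g) (hF.transformsUnder_fstHom _) ?_
  replace hM := mul_mem_siegelModularGroup (fstHom_mem g) hM
  have h2 : (fstHom g * M) (.inr 0) (.inl 0) = 0 := by
    simpa [Matrix.mul_apply, Fintype.sum_sum_type, Fin.sum_univ_two, fstHom] using hg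
  generalize fstHom g * M = M at *
  obtain ⟨g, hg⟩ := exists_specialLinearGroup_row (M (.inl 1) (.inl 0)) (M (.inr 1) (.inl 0))
  refine .of_mul_eq_one (mul_eq_one_of_hom g) (hF.transformsUnder_sndHom _) ?_
  replace hM := mul_mem_siegelModularGroup (sndHom_mem g) hM
  have h3 : (sndHom g * M) (.inr 1) (.inl 0) = 0 := by
    simpa [Matrix.mul_apply, Fintype.sum_sum_type, Fin.sum_univ_two, sndHom] using hg
  replace h2 : (sndHom g * M) (.inr 0) (.inl 0) = 0 := by
    simpa [Matrix.mul_apply, Fintype.sum_sum_type, Fin.sum_univ_two, sndHom] using h2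
  generalize sndHom g * M = M at *
  obtain ⟨g, hg⟩ := exists_specialLinearGroup_row (M (.inl 0) (.inl 0)) (M (.inl 1) (.inl 0))
  refine .of_mul_eq_one (mul_eq_one_of_hom g) (hF.transformsUnder_leviHom _) ?_
  refine hF.transformsUnder_of_fst_column_eq_smul
    (mul_mem_siegelModularGroup (leviHom_mem g) hM) ?_ ?_ ?_
  · simpa [Matrix.mul_apply, Fintype.sum_sum_type, Fin.sum_univ_two, leviHom] using hg
  all_goals
    simp [Matrix.mul_apply, Fintype.sum_sum_type, Fin.sum_univ_two, leviHom, h2, h3]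

end IsSiegelInvariant

lemma binaryForm_pos {a b d s t : ℝ} (ha : 0 < a) (h : b ^ 2 < a * d) (hst : s ≠ 0 ∨ t ≠ 0) :
    0 < a * s ^ 2 + 2 * b * s * t + d * t ^ 2 := by
  have key : a * (a * s ^ 2 + 2 * b * s * t + d * t ^ 2) =
      (a * s + b * t) ^ 2 + (a * d - b ^ 2) * t ^ 2 := by ring
  refine pos_of_mul_pos_right (a := a) ?_ ha.le
  rw [key]
  have h' : 0 < a * d - b ^ 2 := by linarith
  rcases eq_or_ne t 0 with rfl | ht
  · have : s ≠ 0 := by simpa using hst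
    simp only [mul_zero, add_zero]
    positivity
  · positivity

lemma binaryForm_nonneg {a b d : ℝ} (ha : 0 ≤ a) (hd : 0 ≤ d) (h : b ^ 2 ≤ a * d) (s t : ℝ) :
    0 ≤ a * s ^ 2 + 2 * b * s * t + d * t ^ 2 := by
  rcases ha.eq_or_lt with rfl | ha
  · have : b = 0 := by nlinarith
    simp only [this, zero_mul, mul_zero, zero_add]
    positivity
  · refine nonneg_of_mul_nonneg_right (a := a) ?_ ha
    have key : a * (a * s ^ 2 + 2 * b * s * t + d * t ^ 2) =
      (a * s + b * t) ^ 2 + (a * d - b ^ 2) * t ^ 2 := by ring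
    rw [key]
    have h' : 0 ≤ a * d - b ^ 2 := by linarith
    positivity

lemma mem_siegelUpperHalfSpace_iff {Z : Matrix (Fin 2) (Fin 2) ℂ} :
    Z ∈ SiegelUpperHalfSpace 2 ↔ Z ∈ siegelPlane := by
  have hsymm : Z.IsSymm ↔ Z 1 0 = Z 0 1 := by
    rw [Matrix.IsSymm.ext_iff]
    simp [Fin.forall_fin_two, eq_comm]
  change Z.IsSymm ∧ _ ↔ Z 1 0 = Z 0 1 ∧ _
  rw [hsymm]
  refine and_congr_right fun h ↦ ?_
  have hW : (Z - Zᴴ).map (fun w => w / (2 * Complex.I)) = Matrix.of fun i j ↦ ((Z i j).im : ℂ) := by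
    have him (w : ℂ) : (w - star w) / (2 * Complex.I) = (w.im : ℂ) := by
      rw [im_eq_sub_conj]
      rfl
    ext i j
    rw [Matrix.map_apply, Matrix.sub_apply, Matrix.conjTranspose_apply,
      hsymm.mpr h |>.apply i j]
    exact him _
  rw [hW]
  constructor
  · intro hp
    have h0 := hp.diag_pos (i := 0)
    have h1 := hp.det_pos
    rw [det_fin_two] at h1
    simp only [of_apply, h] at h0 h1
    norm_cast at h0 h1
    exact ⟨h0, by linarith⟩
  · rintro ⟨h0, h1⟩
    refine .of_dotProduct_mulVec_pos ?_ fun x hx ↦ ?_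
    · ext i j
      rw [conjTranspose_apply, of_apply, of_apply, hsymm.mpr h |>.apply]
      simp
    · simp only [dotProduct, mulVec, Fin.sum_univ_two, of_apply, h, Pi.star_apply]
      have hx' : (x 0).re ≠ 0 ∨ (x 0).im ≠ 0 ∨ (x 1).re ≠ 0 ∨ (x 1).im ≠ 0 := by
        by_contra! hc
        refine hx (funext ?_)
        simp [Fin.forall_fin_two, Complex.ext_iff, hc]
      have e : star (x 0) * ((Z 0 0).im * x 0 + (Z 0 1).im * x 1) +
          star (x 1) * ((Z 0 1).im * x 0 + (Z 1 1).im * x 1) =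
          ((((Z 0 0).im * (x 0).re ^ 2 + 2 * (Z 0 1).im * (x 0).re * (x 1).re +
            (Z 1 1).im * (x 1).re ^ 2) + ((Z 0 0).im * (x 0).im ^ 2 +
            2 * (Z 0 1).im * (x 0).im * (x 1).im + (Z 1 1).im * (x 1).im ^ 2) : ℝ) : ℂ) := by
        apply Complex.ext <;> simp [pow_two] <;> ring
      rw [e, zero_lt_real]
      generalize (Z 0 0).im = a at *
      generalize (Z 0 1).im = b at *
      generalize (Z 1 1).im = d at *
      have hd : 0 ≤ d := by
        by_contra! hd
        nlinarith [sq_nonneg b]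
      by_cases h2 : (x 0).re ≠ 0 ∨ (x 1).re ≠ 0
      · exact add_pos_of_pos_of_nonneg (binaryForm_pos h0 h1 h2)
          (binaryForm_nonneg h0.le hd h1.le _ _)
      · exact add_pos_of_nonneg_of_pos (binaryForm_nonneg h0.le hd h1.le _ _)
          (binaryForm_pos h0 h1 (by tauto))

lemma IsSiegelInvariant.transform {F : Matrix (Fin 2) (Fin 2) ℂ → ℂ} {k : ℕ}
    (hF : IsSiegelInvariant F k) {M : Matrix (Fin 2 ⊕ Fin 2) (Fin 2 ⊕ Fin 2) ℤ}
    (hM : M ∈ SiegelModularGroup 2) {Z : Matrix (Fin 2) (Fin 2) ℂ} (hZ : Z ∈ siegelPlane) :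
    F (matActS M Z) = ((M.map (fun a => (a : ℂ))).toBlocks₂₁ * Z +
        (M.map (fun a => (a : ℂ))).toBlocks₂₂).det ^ k * F Z := by
  obtain ⟨Z', -, J, hJ, h, hF⟩ := hF.transformsUnder hM Z hZ
  change M.map (fun a ↦ (a : ℂ)) * _ = _ at h
  rw [matActS]
  generalize M.map (fun a => (a : ℂ)) = N at *
  rw [← fromBlocks_toBlocks N, fromBlocks_multiply, fromBlocks_multiply, fromBlocks_inj] at h
  obtain ⟨h1, -, h2, -⟩ := h
  simp only [Matrix.mul_one, Matrix.mul_zero, Matrix.one_mul, add_zero] at h1 h2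
  rw [h1, h2, Matrix.mul_assoc, Matrix.mul_nonsing_inv _ hJ.isUnit, Matrix.mul_one, hF]

lemma exists_int_mul_sum_inv {p : ℕ} (hp : p.Prime) (s : Finset ℕ)
    (hs : ∀ q ∈ s, q.Prime ∧ q ≠ p) :
    ∃ D a : ℤ, ¬(p : ℤ) ∣ D ∧ (D : ℚ) * ∑ q ∈ s, (1 : ℚ) / q = a := by
  have hp' : Prime (p : ℤ) := Nat.prime_iff_prime_int.mp hp
  induction s using Finset.induction_on with
  | empty => exact ⟨1, 0, hp'.not_dvd_one, by simp⟩
  | insert q s hq ih =>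
    obtain ⟨D, a, hD, h⟩ := ih fun r hr ↦ hs r (Finset.mem_insert_of_mem hr)
    obtain ⟨hq1, hq2⟩ := hs q (Finset.mem_insert_self q s)
    refine ⟨q * D, D + q * a, fun hdvd ↦ ?_, ?_⟩
    · rcases hp'.dvd_or_dvd hdvd with h | h
      · exact hq2 ((Nat.prime_dvd_prime_iff_eq hp hq1).mp (by exact_mod_cast h)).symm
      · exact hD h
    · have : (q : ℚ) ≠ 0 := by exact_mod_cast hq1.ne_zero
      rw [Finset.sum_insert hq]
      push_cast
      rw [← h]
      field_simp

/-- The numerator of `p * B_{p-1}` is prime to `p`. -/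
lemma exists_int_mul_prime_mul_bernoulli {p : ℕ} (hp : p.Prime) (hp5 : 5 ≤ p) :
    ∃ D u : ℤ, ¬(p : ℤ) ∣ u ∧ (D : ℚ) * (p * bernoulli (p - 1)) = u := by
  obtain ⟨j, hj⟩ : ∃ j, p - 1 = 2 * j := by
    obtain ⟨j, hj⟩ := hp.odd_of_ne_two (by omega)
    exact ⟨j, by omega⟩
  obtain ⟨N, hN⟩ := Bernoulli.vonStaudt_clausen j
  rw [← hj] at hN
  set s := (Finset.range (p - 1 + 2)).filter fun q ↦ q.Prime ∧ (q - 1) ∣ p - 1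
  have hps : p ∈ s := by
    simp only [s, Finset.mem_filter, Finset.mem_range]
    exact ⟨by omega, hp, dvd_rfl⟩
  rw [← Finset.add_sum_erase s _ hps] at hN
  obtain ⟨D, a, hD, ha⟩ := exists_int_mul_sum_inv hp (s.erase p) fun q hq ↦ by
    simp only [s, Finset.mem_erase, Finset.mem_filter] at hq
    exact ⟨hq.2.2.1, hq.1⟩
  have hp0 : (p : ℚ) ≠ 0 := by exact_mod_cast hp.ne_zero
  refine ⟨D, p * (D * N - a) - D, fun h ↦ hD ?_, ?_⟩
  · simpa using (dvd_sub (dvd_mul_right (p : ℤ) (D * N - a)) h)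
  · push_cast
    rw [← ha, hN]
    field_simp
    ring

lemma isPIntegral_eisenstein_constant {p : ℕ} (hp : p.Prime) (hp5 : 5 ≤ p) (n : ℤ) :
    IsPIntegral p (-(2 * (p - 1 : ℕ) / bernoulli (p - 1) : ℂ) * n / p) := by
  obtain ⟨D, u, hu, h⟩ := exists_int_mul_prime_mul_bernoulli hp hp5
  refine ⟨-(2 * (p - 1 : ℕ) * n * D), u, hu, ?_⟩
  have hB : bernoulli (p - 1) ≠ 0 := by
    rintro h0
    rw [h0, mul_zero, mul_zero] at h
    exact hu (by simp [show u = 0 by exact_mod_cast h.symm])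
  have hB' : (bernoulli (p - 1) : ℂ) ≠ 0 := by exact_mod_cast hB
  have hp0 : (p : ℂ) ≠ 0 := by exact_mod_cast hp.ne_zero
  have h' : (u : ℂ) = D * (p * bernoulli (p - 1)) := by
    rw [← Rat.cast_intCast, ← h]
    push_cast
    rfl
  rw [h']
  push_cast
  field_simp

lemma isPIntegral_zero {p : ℕ} (hp : p.Prime) : IsPIntegral p 0 :=
  ⟨0, 1, (Nat.prime_iff_prime_int.mp hp).not_dvd_one, by simp⟩

lemma isPIntegral_of_div_prime {p : ℕ} (hp : p.Prime) {z : ℂ} (h : IsPIntegral p (z / p)) :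
    IsPIntegral p z := by
  obtain ⟨a, b, hb, h⟩ := h
  have hp0 : (p : ℂ) ≠ 0 := by exact_mod_cast hp.ne_zero
  refine ⟨p * a, b, hb, ?_⟩
  push_cast
  rw [← h]
  field_simp

/-- The binary form `(m, n, r)` attached to the half integral matrix `T`. -/
def formOfMatrix (T : Matrix (Fin 2) (Fin 2) ℚ) : ℤ × ℤ × ℤ :=
  ((T 1 1).num, (T 0 0).num, (2 * T 0 1).num)

lemma num_cast_of_eq {q : ℚ} (h : ∃ a : ℤ, q = a) : (q.num : ℚ) = q := by
  obtain ⟨a, rfl⟩ := h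
  simp

lemma formOfMatrix_cast {T : Matrix (Fin 2) (Fin 2) ℚ} (hT : T ∈ SiegelLattice 2 1) :
    ((formOfMatrix T).1 : ℚ) = T 1 1 ∧ ((formOfMatrix T).2.1 : ℚ) = T 0 0 ∧
      ((formOfMatrix T).2.2 : ℚ) = 2 * T 0 1 := by
  obtain ⟨-, h1, h2, -⟩ := hT
  simp only [Nat.cast_one, one_mul, mul_one] at h1 h2
  exact ⟨num_cast_of_eq (h1 1), num_cast_of_eq (h1 0), num_cast_of_eq (h2 0 1)⟩

lemma eq_of_mem_siegelLattice {T : Matrix (Fin 2) (Fin 2) ℚ} (hT : T ∈ SiegelLattice 2 1) :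
    T = !![((formOfMatrix T).2.1 : ℚ), ((formOfMatrix T).2.2 : ℚ) / 2;
      ((formOfMatrix T).2.2 : ℚ) / 2, ((formOfMatrix T).1 : ℚ)] := by
  obtain ⟨h1, h2, h3⟩ := formOfMatrix_cast hT
  have h := hT.1.apply 0 1
  ext i j
  fin_cases i <;> fin_cases j <;> simp [h1, h2, h3, h]

lemma formOfMatrix_semidefinite {T : Matrix (Fin 2) (Fin 2) ℚ} (hT : T ∈ SiegelLattice 2 1) :
    0 ≤ (formOfMatrix T).2.1 ∧ 0 ≤ (formOfMatrix T).1 ∧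
      (formOfMatrix T).2.2 ^ 2 ≤ 4 * (formOfMatrix T).2.1 * (formOfMatrix T).1 := by
  obtain ⟨h1, h2, h3⟩ := formOfMatrix_cast hT
  have hp := hT.2.2.2
  have p0 := hp.diag_nonneg (i := 0)
  have p1 := hp.diag_nonneg (i := 1)
  have hd := hp.det_nonneg
  rw [det_fin_two] at hd
  simp only [Matrix.map_apply, hT.1.apply 0 1] at p0 p1 hd
  norm_cast at p0 p1 hd
  refine ⟨?_, ?_, ?_⟩
  · rw [← h2] at p0
    exact_mod_cast p0
  · rw [← h1] at p1
    exact_mod_cast p1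
  · have : ((formOfMatrix T).2.2 : ℚ) ^ 2 ≤ 4 * (formOfMatrix T).2.1 * (formOfMatrix T).1 := by
      rw [h1, h2, h3]
      linarith
    exact_mod_cast this

lemma exists_formOfMatrix_eq {x : ℤ × ℤ × ℤ}
    (hx : 0 ≤ x.2.1 ∧ 0 ≤ x.1 ∧ x.2.2 ^ 2 ≤ 4 * x.2.1 * x.1) :
    ∃ T ∈ SiegelLattice 2 1, formOfMatrix T = x := by
  obtain ⟨m, n, r⟩ := x
  obtain ⟨hn, hm, hr⟩ := hx
  simp only at hn hm hr
  refine ⟨!![(n : ℚ), (r : ℚ) / 2; (r : ℚ) / 2, (m : ℚ)], ⟨?_, ?_, ?_, ?_⟩, ?_⟩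
  · ext i j
    fin_cases i <;> fin_cases j <;> simp
  · intro i
    fin_cases i
    · exact ⟨n, by simp⟩
    · exact ⟨m, by simp⟩
  · intro i j
    fin_cases i <;> fin_cases j
    · exact ⟨2 * n, by simp⟩
    · exact ⟨r, by simp; ring⟩
    · exact ⟨r, by simp; ring⟩
    · exact ⟨2 * m, by simp⟩
  · refine .of_dotProduct_mulVec_nonneg ?_ fun v ↦ ?_
    · ext i j
      fin_cases i <;> fin_cases j <;> simp
    · have hn : (0 : ℝ) ≤ n := by exact_mod_cast hn
      have hm : (0 : ℝ) ≤ m := by exact_mod_cast hm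
      have hr : (r : ℝ) ^ 2 ≤ 4 * n * m := by exact_mod_cast hr
      have h := binaryForm_nonneg (b := (r : ℝ) / 2) hn hm (by linarith) (v 0) (v 1)
      simp [dotProduct, mulVec, Fin.sum_univ_two]
      linarith
  · simp [formOfMatrix, mul_div_cancel₀]

lemma injective_formOfMatrix :
    Function.Injective fun T : SiegelLattice 2 1 ↦ formOfMatrix (T : Matrix (Fin 2) (Fin 2) ℚ) := by
  intro T T' h
  ext1
  rw [eq_of_mem_siegelLattice T.2, eq_of_mem_siegelLattice T'.2]
  simp only at h
  rw [h]

lemma trace_eq_formPairing {T : Matrix (Fin 2) (Fin 2) ℚ} (hT : T ∈ SiegelLattice 2 1)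
    {Z : Matrix (Fin 2) (Fin 2) ℂ} (hZ : Z ∈ siegelPlane) :
    ((T.map (fun q => (q : ℂ))) * Z).trace = formPairing (formOfMatrix T) Z := by
  conv_lhs => rw [eq_of_mem_siegelLattice hT]
  simp [Matrix.trace, Matrix.mul_apply, Fin.sum_univ_two, formPairing, hZ.1]
  ring

lemma IsModerate.hasSum_siegelLattice {a : ℤ × ℤ × ℤ → ℂ} (ha : IsModerate a)
    {Z : Matrix (Fin 2) (Fin 2) ℂ} (hZ : Z ∈ siegelPlane) :
    HasSum (fun T : SiegelLattice 2 1 ↦ a (formOfMatrix T) * Complex.exp (2 * Real.pi * Complex.I *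
        (((T : Matrix (Fin 2) (Fin 2) ℚ).map (fun q => (q : ℂ))) * Z).trace))
      (fourierSeries a Z) := by
  refine ((injective_formOfMatrix.hasSum_iff fun x hx ↦ ?_).mpr (ha.hasSum hZ.2)).congr_fun
    fun T ↦ ?_
  · have : a x = 0 := by
      by_contra h
      obtain ⟨T, hT, rfl⟩ := exists_formOfMatrix_eq (ha.support x h)
      exact hx ⟨⟨T, hT⟩, rfl⟩
    rw [this, zero_mul]
  · rw [trace_eq_formPairing T.2 hZ]
    rfl

lemma liftCoeff_zero (β : ℂ) (k : ℕ) (c : ℕ → ℤ) : liftCoeff β k c 0 = 1 := by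
  simp [liftCoeff]

lemma formOfMatrix_zero : formOfMatrix 0 = 0 := by
  simp [formOfMatrix]

lemma zero_mem_siegelLattice : (0 : Matrix (Fin 2) (Fin 2) ℚ) ∈ SiegelLattice 2 1 := by
  obtain ⟨T, hT, h⟩ := exists_formOfMatrix_eq (x := 0) (by simp)
  rw [eq_of_mem_siegelLattice hT, h] at hT
  convert hT
  ext i j
  fin_cases i <;> fin_cases j <;> simp

lemma liftCoeff_formOfMatrix {T : Matrix (Fin 2) (Fin 2) ℚ} (hT : T ∈ SiegelLattice 2 1)
    (hT0 : T ≠ 0) (β : ℂ) (k : ℕ) (c : ℕ → ℤ) :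
    ∃ n : ℤ, liftCoeff β k c (formOfMatrix T) = β * n := by
  have hs := formOfMatrix_semidefinite hT
  rw [liftCoeff, if_pos hs]
  split_ifs with h
  · refine absurd ?_ hT0
    have hr : (formOfMatrix T).2.2 = 0 := by
      have := hs.2.2
      rw [h.1] at this
      nlinarith
    rw [eq_of_mem_siegelLattice hT, hr, h.1, h.2]
    ext i j
    fin_cases i <;> fin_cases j <;> simp
  · exact ⟨_, rfl⟩

open Classical in
/-- The Siegel modular form whose Fourier coefficients are given by a Maass lift. -/
def IsJacobiForm.siegelLift {k : ℕ} {c : ℕ → ℤ} {φ : ℂ → ℂ → ℂ} (h : IsJacobiForm k c φ)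
    (hc : c 0 = 1) (hk : 4 ≤ k) (hk2 : Even k) :
    SiegelModularForm 2 k (SiegelModularGroup 2) 1 where
  toFun := fourierSeries (liftCoeff (-(2 * k / bernoulli k : ℂ)) k c)
  coeff T := if T ∈ SiegelLattice 2 1 then
    liftCoeff (-(2 * k / bernoulli k : ℂ)) k c (formOfMatrix T) else 0
  holo Z hZ := ((isModerate_liftCoeff h.growth _ k).differentiableAt
    (mem_siegelUpperHalfSpace_iff.mp hZ).2).differentiableWithinAt
  transform M hM Z hZ := by
    have hF : IsSiegelInvariant (fourierSeries (liftCoeff (-(2 * k / bernoulli k : ℂ)) k c)) k :=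
      ⟨fourierSeries_translate _, fourierSeries_swap _ k c, fourierSeries_unipotent _ k c,
        fun _ hZ ↦ h.fourierSeries_neg_inv hc hk hk2 hZ⟩
    rw [zpow_natCast]
    exact hF.transform hM (mem_siegelUpperHalfSpace_iff.mp hZ)
  coeff_supported T hT := by
    by_contra h
    exact hT (if_neg h)
  expansion Z hZ := by
    refine ((isModerate_liftCoeff h.growth _ k).hasSum_siegelLattice
      (mem_siegelUpperHalfSpace_iff.mp hZ)).congr_fun fun T ↦ ?_
    rw [if_pos T.2]

/-- **Existence of a mod-p-one Siegel modular form of weight `p - 1`**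
(part of Theorem 3.1, Nagaoka). For a prime `p ≥ 5` there is a Siegel modular
form `F_{p-1}` of degree 2 and weight `p - 1` for `Γ₂ = Sp₂(ℤ)` with
`p`-integral Fourier coefficients such that `F_{p-1} ≡ 1 (mod p)`:
its constant term is `≡ 1 (mod p)` and all other Fourier coefficients are
`≡ 0 (mod p)`. -/
theorem exists_siegel_form_congruent_one
    (p : ℕ) (hp : Nat.Prime p) (hp5 : 5 ≤ p) :
    ∃ F : SiegelModularForm 2 ((p : ℤ) - 1) (SiegelModularGroup 2) 1,
      (∀ T, IsPIntegral p (F.coeff T)) ∧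
      ModCongr p 1 (F.coeff 0) 1 ∧
      ∀ T, T ≠ 0 → ModCongr p 1 (F.coeff T) 0 := by
  have hk2 : Even (p - 1) := hp.even_sub_one (by omega)
  obtain ⟨c, φ, hc, hφ⟩ := exists_isJacobiForm (k := p - 1) (by omega) hk2
  rw [show (p : ℤ) - 1 = (p - 1 : ℕ) by omega]
  have h0 : (hφ.siegelLift hc (by omega) hk2).coeff 0 = 1 := by
    simp only [IsJacobiForm.siegelLift]
    rw [if_pos zero_mem_siegelLattice, formOfMatrix_zero, liftCoeff_zero]
  have h1 : ∀ T, T ≠ 0 → IsPIntegral p ((hφ.siegelLift hc (by omega) hk2).coeff T / p) := by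
    intro T hT
    simp only [IsJacobiForm.siegelLift]
    split_ifs with h
    · obtain ⟨n, hn⟩ := liftCoeff_formOfMatrix h hT
        (-(2 * (p - 1 : ℕ) / bernoulli (p - 1) : ℂ)) (p - 1) c
      rw [hn]
      exact isPIntegral_eisenstein_constant hp hp5 n
    · simpa using isPIntegral_zero hp
  refine ⟨hφ.siegelLift hc (by omega) hk2, fun T ↦ ?_, ?_, fun T hT ↦ ?_⟩
  · by_cases hT : T = 0
    · rw [hT, h0]
      exact ⟨1, 1, (Nat.prime_iff_prime_int.mp hp).not_dvd_one, by simp⟩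
    · exact isPIntegral_of_div_prime hp (h1 T hT)
  · rw [ModCongr, h0]
    simpa using isPIntegral_zero hp
  · rw [ModCongr]
    simpa using h1 T hT

end
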